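/- arXiv:2109.05514 — 2 statements merged into one kernel-verified Lean document; each statement's English description precedes it below -/
import Mathlib

section
/- (Theorem 3(iii)) The full monomial automorphism group of the code L(17) has order 19584 = 2^7 · 3^2 · 17; that is, there are exactly 19584 monomial 36×36 matrices M over GF(3) such that {cM : c ∈ L(17)} = L(17). -/
open Matrix Finset

/-- The Pless matrix `S_q`, with rows and columns indexed by `GF(q) ∪ {∞}`
(`none` playing the role of `∞`), built from the quadratic character of `GF(q)`. -/
def Smat (F : Type) [Field F] [Fintype F] [DecidableEq F] :
    Matrix (Option F) (Option F) ℤ := fun i j =>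
  match i, j with
  | none, none => 0
  | none, some _ => 1
  | some _, none => quadraticChar F (-1)
  | some a, some b => quadraticChar F (a - b)

/-- The matrix `U_q`, obtained from `S_q` by replacing each entry `s_{a,∞}`
(`a ∈ GF(q)`) in the column labeled `∞` by `-1`. -/
def Umat (F : Type) [Field F] [Fintype F] [DecidableEq F] :
    Matrix (Option F) (Option F) ℤ := fun i j =>
  match i, j with
  | some _, none => -1
  | i, j => Smat F i j

/-- The row of the generator matrix `(I | U_q)` of the code `L(q)`,
reduced modulo 3, indexed by `i : Option F`. -/
def genRowL (F : Type) [Field F] [Fintype F] [DecidableEq F] (i : Option F) :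
    (Option F ⊕ Option F) → ZMod 3 := fun j =>
  match j with
  | Sum.inl k => if i = k then 1 else 0
  | Sum.inr k => ((Umat F i k : ℤ) : ZMod 3)

/-- The code `L(q)`: the ternary code of length `2q+2` spanned by the rows of
`(I | U_q)` reduced modulo 3; it is monomially equivalent to the Pless symmetry code. -/
def Lcode (F : Type) [Field F] [Fintype F] [DecidableEq F] :
    Submodule (ZMod 3) ((Option F ⊕ Option F) → ZMod 3) :=
  Submodule.span (ZMod 3) (Set.range (genRowL F))

/-- The Hadamard matrix `H = [[I − U_qᵀ, U_q + I], [I + U_qᵀ, U_q − I]]`. -/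
def Hmat (F : Type) [Field F] [Fintype F] [DecidableEq F] :
    Matrix (Option F ⊕ Option F) (Option F ⊕ Option F) ℤ :=
  Matrix.fromBlocks (1 - (Umat F)ᵀ) (Umat F + 1) (1 + (Umat F)ᵀ) (Umat F - 1)

instance : Fact (Nat.Prime 17) := ⟨by norm_num⟩

/-- The 36-element coordinate index set of `L(17)`. -/
abbrev idx := Option (ZMod 17) ⊕ Option (ZMod 17)

/-- A monomial matrix over `GF(3)`: exactly one nonzero entry in each row and column. -/
def IsMonomial3 (M : Matrix idx idx (ZMod 3)) : Prop :=
  (∀ i, ∃! j, M i j ≠ 0) ∧ (∀ j, ∃! i, M i j ≠ 0)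

/-- The full monomial automorphism group of `L(17)`: the set of monomial matrices `M`
over `GF(3)` with `{cM : c ∈ L(17)} = L(17)`. -/
def monAut : Set (Matrix idx idx (ZMod 3)) :=
  {M | IsMonomial3 M ∧
    (fun c => Matrix.vecMul c M) '' (Lcode (ZMod 17) : Set (idx → ZMod 3)) =
      (Lcode (ZMod 17) : Set (idx → ZMod 3))}

/-- The monomial transformation `v ↦ (ε i * v (π i))ᵢ`. -/
def monoEquiv (π : Equiv.Perm idx) (ε : idx → (ZMod 3)ˣ) :
    (idx → ZMod 3) ≃ₗ[ZMod 3] (idx → ZMod 3) where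
  toFun v i := ε i * v (π i)
  map_add' v w := by ext i; simp [mul_add]
  map_smul' a v := by ext i; simp [mul_left_comm]
  invFun v i := (ε (π.symm i))⁻¹.val * v (π.symm i)
  left_inv v := by
    ext i
    beta_reduce
    rw [Units.inv_mul_cancel_left, Equiv.apply_symm_apply]
  right_inv v := by
    ext i
    beta_reduce
    rw [Equiv.symm_apply_apply, Units.mul_inv_cancel_left]

@[simp] theorem monoEquiv_apply (π : Equiv.Perm idx) (ε : idx → (ZMod 3)ˣ) (v : idx → ZMod 3)
    (i : idx) : monoEquiv π ε v i = ε i * v (π i) := rfl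

/-- The group of monomial transformations preserving `L(17)`. -/
def codeAut : Subgroup ((idx → ZMod 3) ≃ₗ[ZMod 3] (idx → ZMod 3)) where
  carrier := {g | (∃ π ε, g = monoEquiv π ε) ∧ ∀ v, g v ∈ Lcode (ZMod 17) ↔ v ∈ Lcode (ZMod 17)}
  one_mem' := ⟨⟨1, 1, by ext; simp⟩, by simp⟩
  mul_mem' := by
    rintro _ _ ⟨⟨π, ε, rfl⟩, hg⟩ ⟨⟨σ, δ, rfl⟩, hh⟩
    refine ⟨⟨π.trans σ, fun i => ε i * δ (π i), ?_⟩, fun v => ?_⟩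
    · ext v i
      simp [mul_assoc]
    · rw [LinearEquiv.mul_apply, hg, hh]
  inv_mem' := by
    rintro _ ⟨⟨π, ε, rfl⟩, hg⟩
    refine ⟨⟨π.symm, fun i => (ε (π.symm i))⁻¹, ?_⟩, fun v => ?_⟩
    · ext v i
      rfl
    · rw [← hg, ← LinearEquiv.mul_apply, mul_inv_cancel, LinearEquiv.coe_one, id]

/-- The matrix of a linear automorphism acting on row vectors. -/
def rowMatrix (g : (idx → ZMod 3) ≃ₗ[ZMod 3] (idx → ZMod 3)) : Matrix idx idx (ZMod 3) :=
  Matrix.of fun i j => g (Pi.single i 1) j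

theorem vecMul_rowMatrix (g : (idx → ZMod 3) ≃ₗ[ZMod 3] (idx → ZMod 3)) (c : idx → ZMod 3) :
    Matrix.vecMul c (rowMatrix g) = g c := by
  conv_rhs => rw [pi_eq_sum_univ' c, map_sum]
  ext j
  simp only [Matrix.vecMul, dotProduct, rowMatrix, Matrix.of_apply, Finset.sum_apply, map_smul,
    Pi.smul_apply, smul_eq_mul]

theorem rowMatrix_injective : Function.Injective rowMatrix := fun g h hgh => by
  ext1 c
  rw [← vecMul_rowMatrix, hgh, vecMul_rowMatrix]

theorem rowMatrix_monoEquiv (π : Equiv.Perm idx) (ε : idx → (ZMod 3)ˣ) (i j : idx) :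
    rowMatrix (monoEquiv π ε) i j = if π j = i then (ε j : ZMod 3) else 0 := by
  simp [rowMatrix, Pi.single_apply]

theorem isMonomial3_iff (M : Matrix idx idx (ZMod 3)) :
    IsMonomial3 M ↔ ∃ π ε, M = rowMatrix (monoEquiv π ε) := by
  constructor
  · rintro ⟨hrow, hcol⟩
    choose p hp hp' using hcol
    choose r hr hr' using hrow
    refine ⟨⟨p, r, fun j => (hr' _ _ (hp j)).symm, fun i => (hp' _ _ (hr i)).symm⟩,
      fun j => Units.mk0 _ (hp j), ?_⟩
    ext i j
    rw [rowMatrix_monoEquiv]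
    split_ifs with h
    · rw [← h]; rfl
    · by_contra hM
      exact h (hp' _ _ hM).symm
  · rintro ⟨π, ε, rfl⟩
    simp only [IsMonomial3, rowMatrix_monoEquiv, ne_eq, ite_eq_right_iff, Units.ne_zero, imp_false,
      not_not]
    exact ⟨fun i => ⟨π.symm i, by simp, fun j hj => by simp [← hj]⟩, fun j => ⟨π j, rfl,
      fun i hi => hi.symm⟩⟩

theorem monAut_eq_image : monAut = rowMatrix '' (codeAut : Set _) := by
  ext M
  simp only [monAut, Set.mem_ofPred_eq, isMonomial3_iff, Set.mem_image, SetLike.mem_coe]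
  constructor
  · rintro ⟨⟨π, ε, rfl⟩, h⟩
    refine ⟨_, ⟨⟨π, ε, rfl⟩, fun v => ?_⟩, rfl⟩
    simp only [vecMul_rowMatrix] at h
    rw [← SetLike.mem_coe, ← SetLike.mem_coe]
    conv_lhs => rw [← h]
    exact (monoEquiv π ε).injective.mem_set_image
  · rintro ⟨_, ⟨⟨π, ε, rfl⟩, h⟩, rfl⟩
    refine ⟨⟨π, ε, rfl⟩, ?_⟩
    simp only [vecMul_rowMatrix]
    ext v
    simp only [Set.mem_image, SetLike.mem_coe]
    constructor
    · rintro ⟨c, hc, rfl⟩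
      exact (h c).2 hc
    · exact fun hv => ⟨(monoEquiv π ε).symm v, (h _).1 (by simpa using hv), by simp⟩

theorem ncard_monAut : monAut.ncard = Nat.card codeAut := by
  rw [monAut_eq_image, Set.ncard_image_of_injective _ rowMatrix_injective]
  rfl

/-- The entries of `U_17` modulo 3. -/
def Ured (i j : Option (ZMod 17)) : ZMod 3 :=
  match i, j with
  | none, none => 0
  | none, some _ => 1
  | some _, none => -1
  | some a, some b =>
    if a - b = 0 then 0 else if Nat.testBit 107286 (a - b).val then 1 else -1

theorem quadraticChar_seventeen (x : ZMod 17) : ((quadraticChar (ZMod 17) x : ℤ) : ZMod 3) =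
    if x = 0 then 0 else if Nat.testBit 107286 x.val then 1 else -1 := by
  revert x
  decide +kernel

theorem Umat_cast (i j : Option (ZMod 17)) : ((Umat (ZMod 17) i j : ℤ) : ZMod 3) = Ured i j := by
  rcases i with _ | a <;> rcases j with _ | b
  · simp [Umat, Smat, Ured]
  · simp [Umat, Smat, Ured]
  · simp [Umat, Ured]
  · exact quadraticChar_seventeen (a - b)

theorem mem_Lcode_iff (c : idx → ZMod 3) :
    c ∈ Lcode (ZMod 17) ↔ ∀ k, ∑ i, c (Sum.inl i) * Ured i k = c (Sum.inr k) := by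
  rw [Lcode, Submodule.mem_span_range_iff_exists_fun]
  have hl (a : Option (ZMod 17) → ZMod 3) (k) :
      (∑ i, a i • genRowL (ZMod 17) i) (Sum.inl k) = a k := by
    simp [genRowL, Finset.sum_apply]
  have hr (a : Option (ZMod 17) → ZMod 3) (k) :
      (∑ i, a i • genRowL (ZMod 17) i) (Sum.inr k) = ∑ i, a i * Ured i k := by
    simp [genRowL, Finset.sum_apply, Umat_cast]
  constructor
  · rintro ⟨a, rfl⟩ k
    simp only [hl, hr]
  · intro h
    refine ⟨fun i => c (Sum.inl i), funext ?_⟩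
    rintro (k | k)
    · rw [hl]
    · rw [hr, h]

/-- Vectors of `L(17)` with the same left half coincide. -/
theorem Lcode_ext {c d : idx → ZMod 3} (hc : c ∈ Lcode (ZMod 17)) (hd : d ∈ Lcode (ZMod 17))
    (h : ∀ i, c (Sum.inl i) = d (Sum.inl i)) : c = d := by
  rw [mem_Lcode_iff] at hc hd
  funext k
  rcases k with k | k
  · exact h k
  · simp only [← hc, ← hd, h]

theorem monoEquiv_mem_codeAut {π : Equiv.Perm idx} {ε : idx → (ZMod 3)ˣ}
    (h : ∀ i, monoEquiv π ε (genRowL (ZMod 17) i) ∈ Lcode (ZMod 17)) :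
    monoEquiv π ε ∈ codeAut := by
  have hle : (Lcode (ZMod 17)).map (monoEquiv π ε).toLinearMap ≤ Lcode (ZMod 17) := by
    rw [Submodule.map_le_iff_le_comap]
    conv_lhs => rw [Lcode]
    rw [Submodule.span_le]
    rintro _ ⟨i, rfl⟩
    exact h i
  have heq := Submodule.eq_of_le_of_finrank_eq hle (LinearEquiv.finrank_map_eq _ _)
  refine ⟨⟨π, ε, rfl⟩, fun v => ?_⟩
  conv_lhs => rw [← heq]
  exact (monoEquiv π ε).injective.mem_set_image (s := (Lcode (ZMod 17) : Set _))

/-- The words of full weight in `L(17)`, up to sign. -/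
def halfWords : List ℕ := [
  0, 524286, 33440956, 66357626, 132453108, 164469331, 264644072, 328676517, 528763858, 656828747,
  690745681, 715990700, 787007763, 943594662, 985401931, 1001967550, 1031662426, 1057265572,
  1073354477, 1100725121, 1313133207, 1381229219, 1411166631, 1431719256, 1559193797, 1574015525,
  1622055267, 1711988855, 1883065884, 1886665038, 1933193411, 1970541717, 2003935100, 2063062708,
  2114269000, 2146446811, 2201188099, 2626004269, 2717460803, 2762196295, 2770869948, 2822071117,
  2862914226, 3077300226, 3117863307, 3148031049, 3243586247, 3273182332, 3323666200, 3423715567,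
  3765869624, 3773067932, 3846169571, 3866124679, 3940821289, 4007870200, 4125601130, 4228275856,
  4230521163, 4292893621, 4402114055, 4590454362, 4596699239, 4696501658, 4723598758, 4824303201,
  4937291752, 5088737311, 5251746393, 5434921605, 5524130447, 5541739896, 5643880089, 5670268286,
  5725566308, 5799318089, 6125281095, 6154338310, 6235202327, 6295799955, 6393930936, 6418258358,
  6486910349, 6544934498, 6546364664, 6633841403, 6642441508, 6647070258, 6822017437, 6847431133,
  6854433378, 6861744028, 7085932157, 7188627904, 7513663894, 7531214962, 7545873720, 7691814855,
  7732249357, 7881380433, 8015478258, 8109360002, 8250677974, 8348711398, 8354584125, 8456027426,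
  8461042325, 8464918025, 8466824886, 8472116331, 8585787241, 8610689867, 8803965967, 9180646580,
  9193136333, 9207161596, 9226419971, 9392479030, 9446935372, 9648344257, 9740960862, 9817377966,
  9819546996, 9836374952, 9874583504, 9887939243, 9934906353, 9970474316, 10148910906, 10176950335,
  10276667016, 10381940055, 10502968499, 10758987659, 10824171764, 10869581067, 11044317796,
  11047998751, 11075804678, 11083479792, 11113536509, 11211239929, 11287235891, 11340536572,
  11389195522, 11450870472, 11598374035, 11720832438, 11922041593, 12032114609, 12033330196,
  12052907078, 12131972027, 12190502464, 12250562189, 12308414478, 12470142509, 12470499792,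
  12591337767, 12692980223, 12787599730, 12835992430, 12953598905, 12973296411, 13089606854,
  13092729328, 13172165732, 13267682805, 13284620874, 13293878374, 13311654809, 13406892958,
  13493859396, 13617781594, 13630127791, 13643510587, 13646955748, 13694600123, 13708342470,
  13723225912, 13828145945, 13886893287, 13941862672, 14132440175, 14147007248, 14171602171,
  14199752000, 14249661075, 14332897983, 14377255808, 14708015444, 14744825577, 15027327788,
  15062167780, 15091485296, 15092691335, 15152856863, 15301649819, 15383105423, 15408648288,
  15464498713, 15474430360, 15543963239, 15581779665, 15648745518, 15762498721, 16030694374,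
  16032386665, 16218457862, 16349345849, 16361835745, 16500831662, 16696898510, 16709168249,
  16827077526, 16905081118, 16911792708, 16922084649, 16929573905, 16933649772, 16943970519,
  17171574481, 17221117589, 17352424533, 17359063466, 17376555589, 17569864241, 17585514073,
  17607931933, 17872586670, 17949128704, 18237433939, 18354125670, 18361031016, 18386010521,
  18414061050, 18452315655, 18629567635, 18784695916, 18838263999, 18840479560, 18893608600,
  19296164227, 19296640940, 19481659582, 19486605249, 19634279210, 19634755932, 19638831850,
  19663464701, 19672487762, 19717227982, 19748904866, 19775616341, 19869550563, 19885912124,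
  19940948632, 19948885888, 19958253311, 20187766765, 20193161488, 20297559668, 20353376383,
  20507848423, 20553334032, 20584445654, 20587466667, 20591804728, 20763355823, 20856873044,
  20968345543, 21005412711, 21032096792, 21517975317, 21519766122, 21576313239, 21648081386,
  21739162133, 21837195557, 22004029418, 22088373450, 22095735359, 22151347214, 22166959584,
  22226810875, 22326242740, 22394087444, 22422217713, 22559941786, 22574209637, 22680811002,
  22778391044, 22819985702, 22885127752, 22901216658, 22917305563, 22949745517, 23079767475,
  23162956789, 23196748069, 23357854731, 23441402732, 23571581748, 23599855307, 23843821043,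
  23875565596, 23931563989, 24063967075, 24066136106, 24067515541, 24105814156, 24263419767,
  24266117128, 24380742784, 24385557567, 24417044449, 24501124377, 24528268160, 24542729835,
  24616566814, 24711680041, 24939760731, 24940737440, 25045085622, 25182675533, 25241152470,
  25385436159, 25423576105, 25567112402, 25574937318, 25671722716, 25680206635, 25683788244,
  25907197809, 25946330677, 26178951566, 26185196514, 26343807178, 26535365609, 26568979606,
  26587756748, 26622785331, 26655545295, 26708913458, 26783309936, 26813523772, 26987456650,
  27005992789, 27193289376, 27235038902, 27259993439, 27286496887, 27293649352, 27388938103,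
  27416422796, 27445927538, 27536391565, 27544805544, 27550847571, 27613070813, 27656291889,
  27704042034, 27773786573, 27883201058, 28013248256, 28124619543, 28264618207, 28293752354,
  28333415901, 28343204341, 28343943206, 28398979714, 28499322149, 28665271679, 28754249474,
  28803232256, 28821967101, 28837841613, 28947914629, 28980375610, 29168768340, 29221667003,
  29285282915, 29374763353, 29392547334, 29415768746, 29441813035, 29450227013, 29451180457,
  29489389009, 29746528382, 29756419713, 30054393434, 30123811274, 30126456997, 30127410426,
  30182708448, 30185382669, 30305189439, 30603037493, 30765686559, 30817034432, 30928997425,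
  30932521679, 30948860720, 31038779757, 31042948738, 31087402191, 31150609189, 31163035043,
  31297228892, 31460341466, 31524735297, 31815369712, 31891354635, 31947717838, 31997938989,
  32011487539, 32061388748, 32064511187, 32244608858, 32436653582, 32698167411, 32723409345,
  32821219327, 32974565537, 33001139038, 33393272734, 33418336497, 33503875012, 33548710734,
  33580272540, 33654155052, 33809637950, 33823323272, 33843907155, 33858885665, 33867037402,
  33887941037, 33966365558, 34001874089, 34014627670, 34277503702, 34343148961]

/-- The words of full weight in `L(17)`. -/
def fullWords : List ℕ := halfWords ++ halfWords.map fun m => m ^^^ 68719476735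

/-- The words of full weight in the orbit of the all-one word. -/
def hadamardRows : List ℕ := [
  0, 68718952449, 12470499792, 524286, 56249334226, 40594857192, 56248976943, 12470142509,
  68719476735, 62484274408, 20297559668, 24501124377, 43144539417, 24940737440, 28124619543,
  6235202327, 65601613428, 25574937318, 43779716004, 10148910906, 13267682805, 55434855861,
  62594195640, 12250562189, 31042948738, 55931877005, 3117863307, 37680696978, 26535365609,
  42150497129, 48421917067, 44218352358, 43778739295, 24939760731, 67160282938, 13284620874,
  6393930936, 12787599730, 31038779757, 26568979606, 39434193820, 6633841403, 33580272540,
  56468914546, 62077035227, 35139204195, 31297228892, 37676527997, 6125281095, 55451793930,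
  49881212736, 62325545799, 1559193797, 18840479560, 49878997175, 58570565829, 42184111126,
  6642441508, 29285282915, 37556441692, 18838263999, 19717227982, 15648745518, 53137697070,
  51149612494, 15581779665, 17569864241, 37422247843, 62085635332, 49002248753, 31163035043,
  53070731217]

/-- The orbit of the third base word under the stabilizer of the first two. -/
def thirdOrbit : List ℕ := [
  12470499792, 40594857192, 20297559668, 10148910906, 39434193820, 19717227982, 44218352358,
  56468914546, 62594195640, 31297228892, 15648745518, 42184111126, 55451793930, 62085635332,
  31042948738, 49881212736, 24940737440]

/-- The orbit of the fourth base word under the stabilizer of the first three. -/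
def fourthOrbit : List ℕ := [
  29746528382, 48943860394, 27704042034, 8109360002, 3077300226, 11389195522, 12052907078,
  46297259022]

/-- The position of a column label among `0, …, 17`. -/
def halfPos : Option (ZMod 17) → ℕ
  | none => 0
  | some a => a.val + 1

/-- The column label at a given position. -/
def halfLabel : ℕ → Option (ZMod 17)
  | 0 => none
  | n + 1 => some n

/-- The position of a coordinate among `0, …, 35`. -/
def pos : idx → ℕ
  | Sum.inl i => halfPos i
  | Sum.inr i => 18 + halfPos i

/-- The vector with entry `-1` where the binary digit of `m` is `1`, and `1` elsewhere. -/
def word (m : ℕ) : idx → ZMod 3 := fun i => if m.testBit (pos i) then -1 else 1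

theorem halfLabel_halfPos (i : Option (ZMod 17)) : halfLabel (halfPos i) = i := by
  rcases i with _ | a
  · rfl
  · simp [halfLabel, halfPos]

theorem halfPos_lt (i : Option (ZMod 17)) : halfPos i < 18 := by
  rcases i with _ | a
  · simp [halfPos]
  · have := a.val_lt
    simp only [halfPos]
    lia

theorem halfPos_halfLabel {n : ℕ} (hn : n < 18) : halfPos (halfLabel n) = n := by
  rcases n with _ | n
  · rfl
  · simp [halfLabel, halfPos, ZMod.val_natCast_of_lt (show n < 17 by lia)]

theorem sum_range_eighteen {M : Type*} [AddCommMonoid M] (f : ℕ → M) :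
    ∑ n ∈ Finset.range 18, f n = ∑ i, f (halfPos i) := by
  refine Finset.sum_bij' (fun n _ => halfLabel n) (fun i _ => halfPos i) ?_ ?_ ?_ ?_ ?_
  · simp
  · simpa using halfPos_lt
  · exact fun n hn => halfPos_halfLabel (Finset.mem_range.1 hn)
  · exact fun i _ => halfLabel_halfPos i
  · exact fun n hn => by rw [halfPos_halfLabel (Finset.mem_range.1 hn)]

theorem sum_range_thirtySix {M : Type*} [AddCommMonoid M] (f : ℕ → M) :
    ∑ n ∈ Finset.range 36, f n = ∑ i, f (pos i) := by
  rw [Fintype.sum_sum_type, show 36 = 18 + 18 from rfl, Finset.sum_range_add, sum_range_eighteen,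
    sum_range_eighteen]
  rfl

/-- `f n`, with `n` evaluated first. -/
def force {α : Type} (n : ℕ) (f : ℕ → α) : α :=
  match n with
  | 0 => f 0
  | k + 1 => f (k + 1)

theorem force_eq {α : Type} (n : ℕ) (f : ℕ → α) : force n f = f n := by
  cases n <;> rfl

/-- The sign `±1` read off from a binary digit. -/
def digitSign (k i : ℕ) : ZMod 3 := if k.testBit i then -1 else 1

/-- The set, as a bit mask, of all `k < 2 ^ m` with `∑ i < m, digitSign k i * u i = x`. -/
def signMask (u : ℕ → ZMod 3) : ℕ → ZMod 3 → ℕ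
  | 0, x => if x = 0 then 1 else 0
  | m + 1, x => signMask u m (x - u m) ||| signMask u m (x + u m) <<< 2 ^ m

theorem testBit_signMask (u : ℕ → ZMod 3) (m : ℕ) (x : ZMod 3) (k : ℕ) :
    (signMask u m x).testBit k = true ↔
      k < 2 ^ m ∧ ∑ i ∈ Finset.range m, digitSign k i * u i = x := by
  induction m generalizing x k with
  | zero =>
    by_cases hx : x = 0
    · simp [signMask, hx, Nat.testBit_one_eq_true_iff_self_eq_zero]
    · simp [signMask, hx, eq_comm]
  | succ m ih =>
    rw [signMask, Nat.testBit_or, Nat.testBit_shiftLeft, Bool.or_eq_true, Bool.and_eq_true, ih, ih,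
      Finset.sum_range_succ, decide_eq_true_eq]
    rcases lt_or_ge k (2 ^ m) with hk | hk
    · have h2 : k < 2 ^ (m + 1) := by rw [pow_succ]; lia
      simp [hk, hk.not_ge, h2, digitSign, Nat.testBit_lt_two_pow hk, eq_sub_iff_add_eq]
    · obtain ⟨l, rfl⟩ := Nat.exists_eq_add_of_le hk
      rw [Nat.add_sub_cancel_left]
      have hs : ∑ i ∈ Finset.range m, digitSign (2 ^ m + l) i * u i =
          ∑ i ∈ Finset.range m, digitSign l i * u i :=
        Finset.sum_congr rfl fun i hi => by
          rw [digitSign, Nat.testBit_two_pow_add_gt (Finset.mem_range.1 hi), digitSign]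
      rw [hs]
      by_cases hl : l < 2 ^ m
      · have h2 : 2 ^ m + l < 2 ^ (m + 1) := by rw [pow_succ]; lia
        simp [hl, h2, digitSign, Nat.testBit_two_pow_add_eq, Nat.testBit_lt_two_pow hl,
          ← sub_eq_add_neg, sub_eq_iff_eq_add]
      · have h2 : ¬ 2 ^ m + l < 2 ^ (m + 1) := by rw [pow_succ]; lia
        simp [hl, h2]

/-- Evaluates `k` at the three sign masks of `u`. -/
def withSignMasks (u : ℕ → ZMod 3) : ℕ → (ℕ → ℕ → ℕ → Bool) → Bool
  | 0, k => k 1 0 0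
  | m + 1, k => withSignMasks u m fun a b c =>
    let join (x y : ℕ) (f : ℕ → Bool) : Bool := force (x ||| y <<< 2 ^ m) f
    if u m = 0 then join a a fun a' => join b b fun b' => join c c fun c' => k a' b' c'
    else if u m = 1 then join c b fun a' => join a c fun b' => join b a fun c' => k a' b' c'
    else join b c fun a' => join c a fun b' => join a b fun c' => k a' b' c'

theorem withSignMasks_eq (u : ℕ → ZMod 3) (m : ℕ) (k : ℕ → ℕ → ℕ → Bool) :
    withSignMasks u m k = k (signMask u m 0) (signMask u m 1) (signMask u m (-1)) := by
  induction m generalizing k with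
  | zero => rfl
  | succ m ih =>
    have h : ∀ x : ZMod 3, x = 0 ∨ x = 1 ∨ x = -1 := by decide
    have h2 : (1 : ZMod 3) + 1 = -1 := by decide
    have h3 : (-1 : ZMod 3) - 1 = 1 := by decide
    have h4 : (-1 : ZMod 3) + -1 = 1 := by decide
    have h5 : (-1 : ZMod 3) ≠ 1 := by decide
    rw [withSignMasks, ih]
    rcases h (u m) with hu | hu | hu <;> simp [signMask, force_eq, hu, h2, h3, h4, h5]

/-- The signs of the right half of the word of `L(17)` with left half `k` are read off from the
sign masks of the columns of `U_17`. -/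
def redCol (j i : ℕ) : ZMod 3 := Ured (halfLabel i) (halfLabel j)

/-- Checks, for the columns `0, …, j - 1`, that the words on the list satisfy the corresponding
parity equations, and that the words meeting `acc` with nonzero entries in all these columns are
exactly those on the list. -/
def checkColumns : ℕ → ℕ → Bool
  | 0, acc => acc == fullWords.foldr (fun m t => 1 <<< (m % 2 ^ 18) ||| t) 0
  | j + 1, acc => withSignMasks (redCol j) 18 fun _ p n =>
    fullWords.all (fun m => (if m.testBit (18 + j) then n else p).testBit (m % 2 ^ 18)) &&
      force (acc &&& (p ||| n)) (checkColumns j)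

theorem checkColumns_eighteen : checkColumns 18 (2 ^ 2 ^ 18 - 1) = true := by
  decide +kernel

theorem checkColumns_spec {j acc : ℕ} (h : checkColumns j acc = true) :
    (∀ i < j, ∀ m ∈ fullWords, ∑ n ∈ Finset.range 18, digitSign (m % 2 ^ 18) n * redCol i n =
      if m.testBit (18 + i) then -1 else 1) ∧
    ∀ k < 2 ^ 18, acc.testBit k = true →
      (∀ i < j, ∑ n ∈ Finset.range 18, digitSign k n * redCol i n ≠ 0) →
      ∃ m ∈ fullWords, m % 2 ^ 18 = k := by
  induction j generalizing acc with
  | zero =>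
    refine ⟨fun i hi => absurd hi i.not_lt_zero, fun k _ hk _ => ?_⟩
    rw [checkColumns, beq_iff_eq] at h
    rw [h] at hk
    clear h
    generalize fullWords = l at hk ⊢
    induction l with
    | nil => simp at hk
    | cons m l ih =>
      rw [List.foldr_cons, Nat.testBit_or, Bool.or_eq_true, Nat.testBit_shiftLeft,
        Bool.and_eq_true, decide_eq_true_eq, Nat.testBit_one_eq_true_iff_self_eq_zero] at hk
      rcases hk with hk | hk
      · exact ⟨m, List.mem_cons_self, by lia⟩
      · obtain ⟨m', hm', h⟩ := ih hk
        exact ⟨m', List.mem_cons_of_mem _ hm', h⟩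
  | succ j ih =>
    rw [checkColumns, withSignMasks_eq, Bool.and_eq_true, force_eq, List.all_eq_true] at h
    obtain ⟨ih1, ih2⟩ := ih h.2
    refine ⟨fun i hi m hm => ?_, fun k hk hacc hne => ?_⟩
    · rcases (Nat.lt_succ_iff.1 hi).lt_or_eq with hi | rfl
      · exact ih1 i hi m hm
      · have := h.1 m hm
        split_ifs at this ⊢ with hb
        · exact ((testBit_signMask _ _ _ _).1 this).2
        · exact ((testBit_signMask _ _ _ _).1 this).2
    · refine ih2 k hk ?_ fun i hi => hne i (hi.trans j.lt_succ_self)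
      have h3 : ∀ x : ZMod 3, x ≠ 0 → x = 1 ∨ x = -1 := by decide
      rw [Nat.testBit_and, hacc, Bool.true_and, Nat.testBit_or, Bool.or_eq_true,
        testBit_signMask, testBit_signMask]
      exact (h3 _ (hne j j.lt_succ_self)).imp (⟨hk, ·⟩) (⟨hk, ·⟩)

theorem sum_digitSign_mul_redCol (k : ℕ) (j : Option (ZMod 17)) :
    ∑ n ∈ Finset.range 18, digitSign k n * redCol (halfPos j) n =
      ∑ i, digitSign k (halfPos i) * Ured i j := by
  simp only [sum_range_eighteen, redCol, halfLabel_halfPos]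

theorem word_inl (m : ℕ) (i : Option (ZMod 17)) :
    word m (Sum.inl i) = digitSign (m % 2 ^ 18) (halfPos i) := by
  rw [word, pos, digitSign, Nat.testBit_mod_two_pow, decide_eq_true (halfPos_lt i), Bool.true_and]

theorem word_mem_Lcode {m : ℕ} (hm : m ∈ fullWords) : word m ∈ Lcode (ZMod 17) := by
  rw [mem_Lcode_iff]
  intro j
  simp only [word_inl]
  rw [← sum_digitSign_mul_redCol,
    (checkColumns_spec checkColumns_eighteen).1 _ (halfPos_lt j) m hm]
  rfl

theorem exists_eq_word {v : idx → ZMod 3} (hv : v ∈ Lcode (ZMod 17)) (h0 : ∀ i, v i ≠ 0) :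
    ∃ m ∈ fullWords, v = word m := by
  set k := Nat.ofBits fun n : Fin 18 => decide (v (Sum.inl (halfLabel n)) = -1) with hk
  have hsign (i : Option (ZMod 17)) : digitSign k (halfPos i) = v (Sum.inl i) := by
    have h3 : ∀ x : ZMod 3, x ≠ 0 → (if x = -1 then -1 else 1) = x := by decide
    rw [digitSign, hk, Nat.testBit_ofBits_lt _ _ (halfPos_lt i)]
    simpa [halfLabel_halfPos] using h3 _ (h0 (Sum.inl i))
  have hlt : k < 2 ^ 18 := Nat.ofBits_lt_two_pow _
  have hacc : (2 ^ 2 ^ 18 - 1).testBit k = true := by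
    rw [Nat.testBit_two_pow_sub_one, decide_eq_true_eq]
    exact hlt
  obtain ⟨m, hm, hmk⟩ := (checkColumns_spec checkColumns_eighteen).2 k hlt hacc fun i hi => by
    rw [← halfPos_halfLabel hi, sum_digitSign_mul_redCol]
    simp only [hsign]
    rw [(mem_Lcode_iff v).1 hv]
    exact h0 _
  exact ⟨m, hm, Lcode_ext hv (word_mem_Lcode hm) fun i => by rw [word_inl, hmk, hsign]⟩

theorem exists_apply_word_eq {g : (idx → ZMod 3) ≃ₗ[ZMod 3] (idx → ZMod 3)} (hg : g ∈ codeAut)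
    {m : ℕ} (hm : m ∈ fullWords) : ∃ m' ∈ fullWords, g (word m) = word m' := by
  refine exists_eq_word ((hg.2 _).2 (word_mem_Lcode hm)) fun i => ?_
  obtain ⟨π, ε, rfl⟩ := hg.1
  rw [monoEquiv_apply, word]
  refine mul_ne_zero (ε i).ne_zero ?_
  split_ifs <;> decide

/-- The number of binary digits `1` of `c < 64`, read off from a table in base `8`. -/
def digitCount (c : ℕ) : ℕ :=
  (5266721624626081916652898579601397356032429460333936579656 >>> (3 * c)) % 8

theorem digitCount_shiftRight_mod (n k : ℕ) :
    digitCount ((n >>> k) % 64) = ∑ i ∈ Finset.range 6, (n.testBit (k + i)).toNat := by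
  have h : ∀ c < 64, digitCount c = ∑ i ∈ Finset.range 6, (c.testBit i).toNat := by
    decide +kernel
  rw [h _ (Nat.mod_lt _ (by decide))]
  refine Finset.sum_congr rfl fun i hi => ?_
  rw [show 64 = 2 ^ 6 from rfl, Nat.testBit_mod_two_pow, Nat.testBit_shiftRight,
    decide_eq_true (Finset.mem_range.1 hi), Bool.true_and]

/-- The number of entries `-1` of `word m`. -/
def weight (m : ℕ) : ℕ :=
  digitCount ((m >>> 0) % 64) + digitCount ((m >>> 6) % 64) + digitCount ((m >>> 12) % 64) +
    digitCount ((m >>> 18) % 64) + digitCount ((m >>> 24) % 64) + digitCount ((m >>> 30) % 64)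

theorem weight_eq_sum (m : ℕ) : weight m = ∑ i ∈ Finset.range 36, (m.testBit i).toNat := by
  simp only [weight, digitCount_shiftRight_mod, Finset.sum_range_succ, Finset.sum_range_zero,
    Nat.reduceAdd, zero_add, add_assoc]

/-- The number of entries `-1` of a vector. -/
def negCount (v : idx → ZMod 3) : ℕ := #{i | v i = -1}

theorem negCount_word (m : ℕ) : negCount (word m) = weight m := by
  rw [weight_eq_sum, sum_range_thirtySix, negCount, Finset.card_filter]
  refine Finset.sum_congr rfl fun i _ => ?_
  have h : (1 : ZMod 3) ≠ -1 := by decide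
  rw [word]
  cases m.testBit (pos i) <;> simp [h]

theorem negCount_comp (v : idx → ZMod 3) (π : Equiv.Perm idx) :
    negCount (v ∘ π) = negCount v :=
  Finset.card_equiv π (by simp)

theorem word_mul_word (m n : ℕ) : word m * word n = word (m ^^^ n) := by
  ext i
  simp only [Pi.mul_apply, word, Nat.testBit_xor]
  cases m.testBit (pos i) <;> cases n.testBit (pos i) <;> simp

theorem exists_pos_eq {n : ℕ} (hn : n < 36) : ∃ i, pos i = n := by
  rcases lt_or_ge n 18 with h | h
  · exact ⟨Sum.inl (halfLabel n), halfPos_halfLabel h⟩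
  · refine ⟨Sum.inr (halfLabel (n - 18)), ?_⟩
    rw [pos, halfPos_halfLabel (by lia)]
    lia

theorem word_injOn : Set.InjOn word {m | m < 2 ^ 36} := by
  intro m hm n hn h
  refine Nat.eq_of_testBit_eq fun i => ?_
  rcases lt_or_ge i 36 with hi | hi
  · obtain ⟨j, rfl⟩ := exists_pos_eq hi
    have h1 : (1 : ZMod 3) ≠ -1 := by decide
    have := congrFun h j
    simp only [word] at this
    cases hb : m.testBit (pos j) <;> cases hc : n.testBit (pos j) <;>
      simp [hb, hc, h1, h1.symm] at this ⊢
  · have h2 : 2 ^ 36 ≤ 2 ^ i := Nat.pow_le_pow_right two_pos hi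
    rw [Nat.testBit_lt_two_pow (lt_of_lt_of_le hm h2),
      Nat.testBit_lt_two_pow (lt_of_lt_of_le hn h2)]

section Invariants

variable {g : (idx → ZMod 3) ≃ₗ[ZMod 3] (idx → ZMod 3)} {a b c d a' b' c' d' : ℕ}

theorem exists_apply_mul_apply (hg : g ∈ codeAut) :
    ∃ π : Equiv.Perm idx, ∀ u v, g u * g v = (u * v) ∘ π := by
  obtain ⟨⟨π, ε, rfl⟩, -⟩ := hg
  refine ⟨π, fun u v => funext fun i => ?_⟩
  have h : ∀ e : (ZMod 3)ˣ, (e : ZMod 3) * e = 1 := by decide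
  simp only [Pi.mul_apply, monoEquiv_apply, Function.comp_apply]
  rw [mul_mul_mul_comm, h, one_mul]

theorem weight_xor_xor (hg : g ∈ codeAut) (ha : g (word a) = word a') (hb : g (word b) = word b')
    (hc : g (word c) = word c') (hd : g (word d) = word d') :
    weight (a' ^^^ b' ^^^ (c' ^^^ d')) = weight (a ^^^ b ^^^ (c ^^^ d)) := by
  obtain ⟨π, hπ⟩ := exists_apply_mul_apply hg
  simp only [← negCount_word, ← word_mul_word, ← ha, ← hb, ← hc, ← hd, hπ]
  exact negCount_comp (word a * word b * (word c * word d)) π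

theorem weight_xor (hg : g ∈ codeAut) (ha : g (word a) = word a') (hb : g (word b) = word b') :
    weight (a' ^^^ b') = weight (a ^^^ b) := by
  simpa using weight_xor_xor hg ha hb hb hb

theorem exists_eq_apply_word (hg : g ∈ codeAut) (hd : d ∈ fullWords) :
    ∃ d' ∈ fullWords, g (word d') = word d := by
  obtain ⟨d', hd', h⟩ := exists_apply_word_eq (inv_mem hg) hd
  exact ⟨d', hd', by rw [← h, ← LinearEquiv.mul_apply, mul_inv_cancel, LinearEquiv.coe_one, id]⟩

end Invariants

/-- The subgroup of `codeAut` fixing all words on a list. -/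
def wordStab : List ℕ → Subgroup ((idx → ZMod 3) ≃ₗ[ZMod 3] (idx → ZMod 3))
  | [] => codeAut
  | m :: b => MulAction.stabilizer _ (word m) ⊓ wordStab b

theorem mem_wordStab {b : List ℕ} {g : (idx → ZMod 3) ≃ₗ[ZMod 3] (idx → ZMod 3)} :
    g ∈ wordStab b ↔ g ∈ codeAut ∧ ∀ m ∈ b, g (word m) = word m := by
  induction b with
  | nil => simp [wordStab]
  | cons m b ih =>
    rw [wordStab, Subgroup.mem_inf, ih, List.forall_mem_cons, MulAction.mem_stabilizer_iff,
      LinearEquiv.smul_def, and_left_comm]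

theorem card_wordStab {b : List ℕ} {x : ℕ} {l : List ℕ} (hl : l.Nodup) (hlt : ∀ m ∈ l, m < 2 ^ 36)
    (h₁ : ∀ m ∈ l, ∃ g ∈ wordStab b, g (word x) = word m)
    (h₂ : ∀ g ∈ wordStab b, ∃ m ∈ l, g (word x) = word m) :
    Nat.card (wordStab b) = l.length * Nat.card (wordStab (x :: b)) := by
  have hindex : (MulAction.stabilizer ((idx → ZMod 3) ≃ₗ[ZMod 3] (idx → ZMod 3)) (word x)).relIndex
      (wordStab b) = l.length := by
    have : (MulAction.orbit (wordStab b) (word x)) = word '' (l.toFinset : Set ℕ) := by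
      ext v
      simp only [MulAction.mem_orbit_iff, Set.mem_image, List.coe_toFinset, Set.mem_ofPred_eq]
      constructor
      · rintro ⟨⟨g, hg⟩, rfl⟩
        obtain ⟨m, hm, h⟩ := h₂ g hg
        exact ⟨m, hm, h.symm⟩
      · rintro ⟨m, hm, rfl⟩
        obtain ⟨g, hg, h⟩ := h₁ m hm
        exact ⟨⟨g, hg⟩, h⟩
    rw [← List.toFinset_card_of_nodup hl, ← Set.ncard_coe_finset,
      ← (word_injOn.mono fun m hm => hlt m (by simpa using hm)).ncard_image, ← this,
      ← MulAction.index_stabilizer]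
    rfl
  rw [← hindex, ← Subgroup.inf_relIndex_right, ← Subgroup.relIndex_bot_left,
    ← Subgroup.relIndex_bot_left, mul_comm]
  exact (Subgroup.relIndex_mul_relIndex _ _ _ bot_le inf_le_right).symm

/-- Checks that each word on the second list is the image, under one of the monomial
transformations `gens`, of an earlier word on the two lists. -/
def reaches (gens : List (Equiv.Perm idx × (idx → (ZMod 3)ˣ))) : List ℕ → List ℕ → Bool
  | _, [] => true
  | seen, m :: rest =>
    (seen.any fun k => gens.any fun g => decide (∀ i, g.2 i * word k (g.1 i) = word m i)) &&
      reaches gens (seen ++ [m]) rest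

theorem exists_apply_of_reaches {K : Subgroup ((idx → ZMod 3) ≃ₗ[ZMod 3] (idx → ZMod 3))} {x : ℕ}
    {gens : List (Equiv.Perm idx × (idx → (ZMod 3)ˣ))}
    (hgens : ∀ g ∈ gens, monoEquiv g.1 g.2 ∈ K) {seen l : List ℕ}
    (hseen : ∀ m ∈ seen, ∃ g ∈ K, g (word x) = word m) (h : reaches gens seen l = true) :
    ∀ m ∈ l, ∃ g ∈ K, g (word x) = word m := by
  induction l generalizing seen with
  | nil => simp
  | cons m l ih =>
    simp only [reaches, Bool.and_eq_true, List.any_eq_true, decide_eq_true_eq] at h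
    obtain ⟨⟨k, hk, f, hf, hfk⟩, h⟩ := h
    have hm : ∃ g ∈ K, g (word x) = word m := by
      obtain ⟨g, hg, hgk⟩ := hseen k hk
      refine ⟨_, mul_mem (hgens f hf) hg, ?_⟩
      rw [LinearEquiv.mul_apply, hgk]
      exact funext hfk
    refine List.forall_mem_cons.2 ⟨hm, ih (fun n hn => ?_) h⟩
    rcases List.mem_append.1 hn with hn | hn
    · exact hseen n hn
    · rwa [List.mem_singleton.1 hn]

/-- The coordinate permutation acting by `σ` on both halves. -/
def bothHalves (σ : Equiv.Perm (Option (ZMod 17))) : Equiv.Perm idx := Equiv.sumCongr σ σ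

/-- The permutation `a ↦ u * a` of `GF(17) ∪ {∞}`. -/
def mulPerm (u : (ZMod 17)ˣ) : Equiv.Perm (Option (ZMod 17)) := Equiv.optionCongr (Units.mulLeft u)

/-- The unit `3` of `GF(17)`. -/
def unitThree : (ZMod 17)ˣ := ⟨3, 6, by decide, by decide⟩

/-- The permutation `a ↦ -a⁻¹` of `GF(17) ∪ {∞}`. -/
def negInvPerm : Equiv.Perm (Option (ZMod 17)) :=
  Function.Involutive.toPerm
    (fun i => match i with
      | none => some 0
      | some a => if a = 0 then none else some (-a ^ 15))
    (by unfold Function.Involutive; decide +kernel)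

/-- The translation `a ↦ a + 1` on both halves. -/
def translation : Equiv.Perm idx × (idx → (ZMod 3)ˣ) :=
  (bothHalves (Equiv.optionCongr (Equiv.addRight 1)), 1)

/-- The multiplication `a ↦ 3 * a` followed by the exchange of the two halves. -/
def exchange : Equiv.Perm idx × (idx → (ZMod 3)ˣ) :=
  ((Equiv.sumComm _ _).trans (bothHalves (mulPerm unitThree)), 1)

/-- The square of `exchange`. -/
def exchangeSq : Equiv.Perm idx × (idx → (ZMod 3)ˣ) :=
  (bothHalves (mulPerm (unitThree * unitThree)), 1)

/-- The multiplication `a ↦ 3 * a` on both halves, with signs. -/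
def signedMul : Equiv.Perm idx × (idx → (ZMod 3)ˣ) :=
  (bothHalves (mulPerm unitThree), fun i =>
    match i with
    | Sum.inl none => -1
    | Sum.inr (some _) => -1
    | _ => 1)

/-- The map `a ↦ -a⁻¹` on both halves, with signs. -/
def signedInv : Equiv.Perm idx × (idx → (ZMod 3)ˣ) :=
  (bothHalves negInvPerm, fun i =>
    match i with
    | Sum.inl none => 1
    | Sum.inl (some a) => if a = 0 ∨ Nat.testBit 107286 a.val then 1 else -1
    | Sum.inr none => -1
    | Sum.inr (some a) => if Nat.testBit 107286 a.val then 1 else -1)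

theorem genRowL_eq (i : Option (ZMod 17)) :
    genRowL (ZMod 17) i = Sum.elim (fun k => if i = k then 1 else 0) (Ured i) := by
  funext j
  rcases j with j | j
  · rfl
  · exact Umat_cast i j

/-- The monomial transformations used to connect words of full weight. -/
def generators : List (Equiv.Perm idx × (idx → (ZMod 3)ˣ)) :=
  [translation, exchange, signedMul, signedInv, exchangeSq]

theorem generators_mem_codeAut : ∀ g ∈ generators, monoEquiv g.1 g.2 ∈ codeAut := by
  have h : ∀ g ∈ generators, ∀ i k : Option (ZMod 17),
      ∑ j, ((g.2 (Sum.inl j) : ZMod 3) *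
        (Sum.elim (fun k => if i = k then 1 else 0) (Ured i) : idx → ZMod 3) (g.1 (Sum.inl j))) *
          Ured j k =
        g.2 (Sum.inr k) *
          (Sum.elim (fun k => if i = k then 1 else 0) (Ured i) : idx → ZMod 3)
            (g.1 (Sum.inr k)) := by
    decide +kernel
  refine fun g hg => monoEquiv_mem_codeAut fun i => ?_
  rw [mem_Lcode_iff, genRowL_eq]
  exact h g hg i

theorem reaches_hadamardRows :
    reaches [translation, exchange, signedMul, signedInv] [0] hadamardRows.tail = true := by
  decide +kernel

theorem generators_mem_wordStab {gens : List (Equiv.Perm idx × (idx → (ZMod 3)ˣ))} {b : List ℕ}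
    (hgens : gens ⊆ generators)
    (h : ∀ g ∈ gens, ∀ m ∈ b, ∀ i, g.2 i * word m (g.1 i) = word m i) :
    ∀ g ∈ gens, monoEquiv g.1 g.2 ∈ wordStab b := fun g hg =>
  mem_wordStab.2 ⟨generators_mem_codeAut g (hgens hg), fun m hm => funext (h g hg m hm)⟩

theorem exists_apply_eq_hadamardRow :
    ∀ m ∈ hadamardRows, ∃ g ∈ wordStab [], g (word 0) = word m := by
  have h : ∀ m ∈ [0], ∃ g ∈ wordStab [], g (word 0) = word m := by
    simpa using ⟨1, one_mem _, rfl⟩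
  rw [show hadamardRows = 0 :: hadamardRows.tail from rfl, List.forall_mem_cons]
  exact ⟨h 0 List.mem_cons_self, exists_apply_of_reaches
    (generators_mem_wordStab (by simp [generators]) (by simp)) h reaches_hadamardRows⟩

theorem apply_word_zero {g : (idx → ZMod 3) ≃ₗ[ZMod 3] (idx → ZMod 3)} (hg : g ∈ codeAut) :
    ∃ m ∈ hadamardRows, g (word 0) = word m := by
  have h₁ : ∀ m ∈ fullWords, m ∈ hadamardRows ∨ ∃ d ∈ fullWords, weight (m ^^^ d) = 12 := by
    decide +kernel
  have h₂ : ∀ d ∈ fullWords, weight (0 ^^^ d) ≠ 12 := by decide +kernel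
  obtain ⟨m, hm, hgm⟩ := exists_apply_word_eq (m := 0) hg (by decide +kernel)
  refine ⟨m, (h₁ m hm).resolve_right ?_, hgm⟩
  rintro ⟨d, hd, hmd⟩
  obtain ⟨d', hd', hgd⟩ := exists_eq_apply_word hg hd
  exact h₂ d' hd' ((weight_xor hg hgm hgd).symm.trans hmd)

theorem apply_hadamardRow {g : (idx → ZMod 3) ≃ₗ[ZMod 3] (idx → ZMod 3)} (hg : g ∈ codeAut)
    {m : ℕ} (hm : m ∈ hadamardRows) : ∃ m' ∈ hadamardRows, g (word m) = word m' := by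
  obtain ⟨h, hh, hhm⟩ := exists_apply_eq_hadamardRow m hm
  rw [← hhm]
  exact apply_word_zero (mul_mem hg hh)

theorem card_codeAut : Nat.card codeAut = 72 * Nat.card (wordStab [0]) :=
  card_wordStab (b := []) (l := hadamardRows) (by decide +kernel) (by decide +kernel)
    exists_apply_eq_hadamardRow fun _ => apply_word_zero

theorem card_wordStab_zero :
    Nat.card (wordStab [0]) = 2 * Nat.card (wordStab [68718952449, 0]) := by
  refine card_wordStab (l := [68718952449, 524286]) (by decide) (by decide) ?_ fun g hg => ?_
  · have h : ∀ m ∈ [68718952449], ∃ g ∈ wordStab [0], g (word 68718952449) = word m := by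
      simpa using ⟨1, one_mem _, rfl⟩
    rw [List.forall_mem_cons]
    exact ⟨h _ List.mem_cons_self, exists_apply_of_reaches (gens := [exchange])
      (generators_mem_wordStab (by simp [generators]) (by decide +kernel)) h (by decide +kernel)⟩
  · have h₁ : ∀ m ∈ hadamardRows, weight (m ^^^ 0) = 18 → m ∈ [68718952449, 524286] ∨
        ∃ d ∈ hadamardRows, ∃ e ∈ hadamardRows, weight (m ^^^ 0 ^^^ (d ^^^ e)) = 12 := by
      decide +kernel
    have h₂ : ∀ d ∈ hadamardRows, ∀ e ∈ hadamardRows,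
        weight (68718952449 ^^^ 0 ^^^ (d ^^^ e)) ≠ 12 := by
      decide +kernel
    obtain ⟨hg, h0⟩ := mem_wordStab.1 hg
    replace h0 := h0 0 (by simp)
    obtain ⟨m, hm, hgm⟩ := apply_hadamardRow hg (m := 68718952449) (by decide +kernel)
    refine ⟨m, (h₁ m hm ?_).resolve_right ?_, hgm⟩
    · rw [weight_xor hg hgm h0]
      decide +kernel
    · rintro ⟨d, hd, e, he, h⟩
      obtain ⟨d', hd', hgd⟩ := apply_hadamardRow (inv_mem hg) hd
      obtain ⟨e', he', hge⟩ := apply_hadamardRow (inv_mem hg) he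
      have hinv {k k' : ℕ} (hk : g⁻¹ (word k) = word k') : g (word k') = word k := by
        rw [← hk, ← LinearEquiv.mul_apply, mul_inv_cancel, LinearEquiv.coe_one, id]
      exact h₂ d' hd' e' he' ((weight_xor_xor hg hgm h0 (hinv hgd) (hinv hge)).symm.trans h)

/-- The weights of the products of `word m` with pairs of words on a list. -/
def profile (b : List ℕ) (m : ℕ) : List ℕ :=
  b.flatMap fun x => b.map fun y => weight (m ^^^ 0 ^^^ (x ^^^ y))

theorem profile_eq {b : List ℕ} {g : (idx → ZMod 3) ≃ₗ[ZMod 3] (idx → ZMod 3)}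
    (hg : g ∈ wordStab b) (h0 : 0 ∈ b) {m m' : ℕ} (hm : g (word m) = word m') :
    profile b m' = profile b m := by
  obtain ⟨hg, hb⟩ := mem_wordStab.1 hg
  refine List.flatMap_congr fun x hx => List.map_congr_left fun y hy => ?_
  exact weight_xor_xor hg hm (hb 0 h0) (hb x hx) (hb y hy)

/-- The weights of products involving `word m`, `word d`, and the second base word. -/
def crossWeights (m d : ℕ) : List ℕ :=
  [weight (d ^^^ 0), weight (d ^^^ 68718952449), weight (m ^^^ d),
    weight (m ^^^ 68718952449 ^^^ (d ^^^ 0))]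

theorem crossWeights_eq {g : (idx → ZMod 3) ≃ₗ[ZMod 3] (idx → ZMod 3)}
    (hg : g ∈ wordStab [68718952449, 0]) {m m' d d' : ℕ} (hm : g (word m) = word m')
    (hd : g (word d) = word d') : crossWeights m' d' = crossWeights m d := by
  obtain ⟨hg, hb⟩ := mem_wordStab.1 hg
  have h0 := hb 0 (by simp)
  have h1 := hb 68718952449 (by simp)
  rw [crossWeights, crossWeights, weight_xor hg hd h0, weight_xor hg hd h1, weight_xor hg hm hd,
    weight_xor_xor hg hm h1 hd h0]

theorem card_wordStab_hadamard :
    Nat.card (wordStab [68718952449, 0]) =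
      17 * Nat.card (wordStab [12470499792, 68718952449, 0]) := by
  refine card_wordStab (l := thirdOrbit) (by decide +kernel) (by decide +kernel) ?_ fun g hg => ?_
  · have h : ∀ m ∈ [12470499792],
        ∃ g ∈ wordStab [68718952449, 0], g (word 12470499792) = word m := by
      simpa using ⟨1, one_mem _, rfl⟩
    rw [show thirdOrbit = 12470499792 :: thirdOrbit.tail from rfl, List.forall_mem_cons]
    exact ⟨h _ List.mem_cons_self, exists_apply_of_reaches (gens := [translation])
      (generators_mem_wordStab (by simp [generators]) (by decide +kernel)) h (by decide +kernel)⟩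
  · have h₁ : ∀ m ∈ fullWords, profile [68718952449, 0] m = profile [68718952449, 0] 12470499792 →
        m ∈ thirdOrbit ∨
          ∃ d ∈ fullWords, crossWeights m d ∈ [[15, 15, 21, 11], [15, 21, 15, 11]] := by
      decide +kernel
    have h₂ : ∀ d ∈ fullWords,
        crossWeights 12470499792 d ∉ [[15, 15, 21, 11], [15, 21, 15, 11]] := by
      decide +kernel
    have hg' := (mem_wordStab.1 hg).1
    obtain ⟨m, hm, hgm⟩ := exists_apply_word_eq hg' (m := 12470499792) (by decide +kernel)
    refine ⟨m, (h₁ m hm (profile_eq hg (by simp) hgm)).resolve_right ?_, hgm⟩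
    rintro ⟨d, hd, h⟩
    obtain ⟨d', hd', hgd⟩ := exists_eq_apply_word hg' hd
    exact h₂ d' hd' (crossWeights_eq hg hgm hgd ▸ h)

theorem card_wordStab_third :
    Nat.card (wordStab [12470499792, 68718952449, 0]) =
      8 * Nat.card (wordStab [29746528382, 12470499792, 68718952449, 0]) := by
  refine card_wordStab (l := fourthOrbit) (by decide +kernel) (by decide +kernel) ?_ fun g hg => ?_
  · have h : ∀ m ∈ [29746528382], ∃ g ∈ wordStab [12470499792, 68718952449, 0],
        g (word 29746528382) = word m := by
      simpa using ⟨1, one_mem _, rfl⟩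
    rw [show fourthOrbit = 29746528382 :: fourthOrbit.tail from rfl, List.forall_mem_cons]
    exact ⟨h _ List.mem_cons_self, exists_apply_of_reaches (gens := [exchangeSq])
      (generators_mem_wordStab (by simp [generators]) (by decide +kernel)) h (by decide +kernel)⟩
  · have h : ∀ m ∈ fullWords, profile [12470499792, 68718952449, 0] m =
        profile [12470499792, 68718952449, 0] 29746528382 → m ∈ fourthOrbit := by
      decide +kernel
    obtain ⟨m, hm, hgm⟩ := exists_apply_word_eq (mem_wordStab.1 hg).1
      (m := 29746528382) (by decide +kernel)
    exact ⟨m, h m hm (profile_eq hg (by simp) hgm), hgm⟩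

/-- Words of full weight that are determined by their profiles. -/
def fixedWords : List ℕ := [55407821926, 62077035227, 50267161080, 132453108, 27293649352]

theorem wordStab_eq_bot : wordStab [29746528382, 12470499792, 68718952449, 0] = ⊥ := by
  have hprofile : ∀ m ∈ fullWords, ∀ k ∈ fixedWords,
      profile [29746528382, 12470499792, 68718952449, 0] m =
        profile [29746528382, 12470499792, 68718952449, 0] k → m = k := by
    decide +kernel
  have hsep : ∀ i j : idx, (∀ k ∈ [29746528382, 12470499792, 68718952449, 0] ++ fixedWords,
      word k i = word k j) → i = j := by
    decide +kernel
  refine (Subgroup.eq_bot_iff_forall _).2 fun g hg => ?_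
  have hfix : ∀ k ∈ [29746528382, 12470499792, 68718952449, 0] ++ fixedWords,
      g (word k) = word k := by
    refine List.forall_mem_append.2 ⟨(mem_wordStab.1 hg).2, fun k hk => ?_⟩
    have hkf : ∀ k ∈ fixedWords, k ∈ fullWords := by decide +kernel
    obtain ⟨m, hm, hgm⟩ := exists_apply_word_eq (mem_wordStab.1 hg).1 (hkf k hk)
    rw [hgm, hprofile m hm k hk (profile_eq hg (by simp) hgm)]
  obtain ⟨⟨π, ε, rfl⟩, -⟩ := (mem_wordStab.1 hg).1
  have hε (i : idx) : (ε i : ZMod 3) = 1 := by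
    simpa [word] using congrFun (hfix 0 (by simp)) i
  ext v i
  rw [monoEquiv_apply, hε, one_mul, hsep (π i) i fun k hk => by
    simpa [hε] using congrFun (hfix k hk) i]
  rfl

/-- (Theorem 3(iii)) The full monomial automorphism group of `L(17)` has order
`19584 = 2^7 · 3^2 · 17`. -/
theorem stmt_15 : Set.ncard monAut = 19584 := by
  rw [ncard_monAut, card_codeAut, card_wordStab_zero, card_wordStab_hadamard, card_wordStab_third,
    wordStab_eq_bot, Subgroup.card_bot]
end

section
/- Under the action of the full monomial automorphism group of L(17), the 888 codewords of weight 36 in L(17) form exactly two orbits, of lengths 72 and 816; the orbit of length 72 consists precisely of the rows of H and of 2H reduced modulo 3, where H = [[I_{18} − U_{17}ᵀ, U_{17} + I_{18}], [I_{18} + U_{17}ᵀ, U_{17} − I_{18}]]. -/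
open Matrix Finset

/-- The set of codewords of weight 36 (all coordinates nonzero) of `L(17)`. -/
def fullWt : Set (idx → ZMod 3) := {c | c ∈ Lcode (ZMod 17) ∧ ∀ j, c j ≠ 0}

/-- The rows of `H` and of `2H`, reduced modulo 3. -/
def rowsH2H : Set (idx → ZMod 3) :=
  {c | ∃ (s : Bool) (i : idx),
    c = fun j => (if s then 1 else 2) * ((Hmat (ZMod 17) i j : ℤ) : ZMod 3)}

namespace L17

/-! ### Computable models of codewords and of the code -/

/-- `withNat n f = f n`, in a form whose kernel reduction evaluates `n` first. -/
def withNat {α : Type} (n : ℕ) (f : ℕ → α) : α :=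
  Nat.rec (f 0) (fun k _ => f (Nat.succ k)) n

/-- The entry of `U_17` modulo 3 in terms of positions (`∞` has position `0` and `a` has position
`a + 1`); `107286` is the bit set of the nonzero squares modulo 17. -/
def entry (i k : ℕ) : ℕ :=
  if i = 0 then (if k = 0 then 0 else 1)
  else if k = 0 then 2
  else if i = k then 0
  else if Nat.testBit 107286 ((i + 17 - k) % 17) then 1 else 2

/-- Signed permutation of the coordinates of a word given by its bits: bit `j` of the result is bit
`g[j] / 2` of `n`, flipped when `g[j]` is odd. -/
def act : List ℕ → ℕ → ℕ
  | [], _ => 0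
  | e :: t, n => 2 * act t n + (n >>> (e / 2) + e) % 2

/-- The automorphism induced by `x ↦ x + 1`. -/
def translation : List ℕ :=
  [0, 34, 2, 4, 6, 8, 10, 12, 14, 16, 18, 20, 22, 24, 26, 28, 30, 32, 36, 70, 38, 40, 42, 44,
   46, 48, 50, 52, 54, 56, 58, 60, 62, 64, 66, 68]

/-- The automorphism induced by `x ↦ 3 / x`. -/
def inversion : List ℕ :=
  [2, 1, 8, 22, 5, 12, 11, 21, 33, 24, 14, 7, 19, 29, 26, 35, 16, 30, 38, 37, 45, 59, 40, 49,
   46, 56, 68, 61, 51, 42, 54, 64, 63, 70, 53, 67]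

/-- The automorphism exchanging the two halves of the coordinates. -/
def exchange : List ℕ :=
  [36, 39, 41, 43, 45, 47, 49, 51, 53, 55, 57, 59, 61, 63, 65, 67, 69, 71, 1, 2, 4, 6, 8, 10,
   12, 14, 16, 18, 20, 22, 24, 26, 28, 30, 32, 34]

/-- Generators of a group of automorphisms with exactly two orbits on the words of weight 36. -/
def generators : List (List ℕ) := [translation, inversion, exchange]

/-- Depth-first search of the orbits of the words in a stack; a word is recognized by its low
18 bits, and `vis` is the bit set of those already visited. -/
def explore (gs : List (List ℕ)) : ℕ → List ℕ → ℕ → List ℕ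
  | 0, _, _ => []
  | _ + 1, [], _ => []
  | fuel + 1, n :: st, vis =>
    withNat n fun n =>
      bif vis.testBit (n % 2 ^ 18) then explore gs fuel st vis
      else withNat (vis ||| 1 <<< (n % 2 ^ 18)) fun vis =>
        n :: explore gs fuel (gs.map (act · n) ++ st) vis

/-- The orbit of the all-one word. -/
def orbitA : List ℕ := explore generators 300 [0] 0

/-- The orbit of a word of weight 36 that is not a row of `±H`. -/
def orbitB : List ℕ := explore generators 3300 [33440956] 0

/-- The bit sets of those `m < 2 ^ n` for which `∑ i < n, ±a i` is `0`, `1`, `2` modulo 3, the sign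
of `a i` being `-` when bit `i` of `m` is set. -/
def resMasks (a : ℕ → ℕ) : ℕ → ℕ × ℕ × ℕ
  | 0 => (1, 0, 0)
  | n + 1 =>
    match resMasks a n with
    | (x, y, z) =>
      withNat x fun x => withNat y fun y => withNat z fun z =>
        match a n % 3 with
        | 0 => (x ||| x <<< 2 ^ n, y ||| y <<< 2 ^ n, z ||| z <<< 2 ^ n)
        | 1 => (z ||| y <<< 2 ^ n, x ||| z <<< 2 ^ n, y ||| x <<< 2 ^ n)
        | _ => (y ||| z <<< 2 ^ n, z ||| x <<< 2 ^ n, x ||| y <<< 2 ^ n)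

/-- The bit set of the messages whose codeword is nonzero at coordinate `18 + k`. -/
def nonzeroMask (k : ℕ) : ℕ :=
  match resMasks (entry · k) 18 with
  | (_, y, z) => y ||| z

/-- The bit set of the messages whose codeword is nonzero at coordinates `18, …, 18 + k`. -/
def candidates : ℕ → ℕ
  | 0 => nonzeroMask 0
  | k + 1 => nonzeroMask (k + 1) &&& candidates k

/-- The bit set of the low 18 bits of the words in a list. -/
def messageMask : List ℕ → ℕ
  | [] => 0
  | n :: l => 1 <<< (n % 2 ^ 18) ||| messageMask l

/-- Hamming distance of two words of 36 bits. -/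
def dist (n m : ℕ) : ℕ := ((List.range 36).map fun j => ((n ^^^ m) >>> j) % 2).sum

theorem computation :
    orbitA.length = 72 ∧ orbitB.length = 816 ∧ candidates 17 = messageMask (orbitA ++ orbitB) ∧
      (∀ n ∈ orbitA ++ orbitB, dist 0 n ≠ 12) ∧ ∃ n ∈ orbitB, dist 33440956 n = 12 := by
  decide +kernel

theorem withNat_eq {α : Type} (n : ℕ) (f : ℕ → α) : withNat n f = f n := by
  cases n <;> rfl

theorem testBit_act (g : List ℕ) (n j : ℕ) (hj : j < g.length) :
    (act g n).testBit j = (n.testBit (g[j] / 2) ^^ g[j].testBit 0) := by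
  induction g generalizing j with
  | nil => simp at hj
  | cons e t ih =>
    have hbit : (n >>> (e / 2) + e) % 2 = (n.testBit (e / 2) ^^ e.testBit 0).toNat := by
      rw [Nat.testBit_eq_decide_div_mod_eq, Nat.testBit_eq_decide_div_mod_eq,
        Nat.shiftRight_eq_div_pow, Nat.add_mod]
      rcases Nat.mod_two_eq_zero_or_one (n / 2 ^ (e / 2)) with h | h <;>
        rcases Nat.mod_two_eq_zero_or_one e with h' | h' <;> simp [h, h']
    rw [act, hbit]
    cases j with
    | zero =>
      rw [List.getElem_cons_zero]
      generalize (n.testBit (e / 2) ^^ e.testBit 0) = b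
      cases b <;> simp
    | succ j =>
      have hj' : j < t.length := by simpa using hj
      rw [Nat.testBit_succ, List.getElem_cons_succ, ← ih j hj']
      congr 1
      have := Bool.toNat_lt (n.testBit (e / 2) ^^ e.testBit 0)
      omega

theorem explore_induction {gs : List (List ℕ)} {R : ℕ → Prop}
    (hR : ∀ g ∈ gs, ∀ n, R n → R (act g n)) (fuel : ℕ) (st : List ℕ) (vis : ℕ)
    (hst : ∀ n ∈ st, R n) : ∀ n ∈ explore gs fuel st vis, R n := by
  induction fuel generalizing st vis with
  | zero => simp [explore]
  | succ fuel ih =>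
    cases st with
    | nil => simp [explore]
    | cons n st =>
      have hn : R n := hst n (by simp)
      have hst' : ∀ m ∈ st, R m := fun m hm => hst m (by simp [hm])
      simp only [explore, withNat_eq, cond_eq_ite]
      split_ifs
      · exact ih st vis hst'
      · intro m hm
        rcases List.mem_cons.1 hm with rfl | hm
        · exact hn
        · refine ih _ _ (fun k hk => ?_) m hm
          rcases List.mem_append.1 hk with hk | hk
          · obtain ⟨g, hg, rfl⟩ := List.mem_map.1 hk
            exact hR g hg n hn
          · exact hst' k hk

theorem explore_nodup (gs : List (List ℕ)) (fuel : ℕ) (st : List ℕ) (vis : ℕ) :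
    (∀ n ∈ explore gs fuel st vis, vis.testBit (n % 2 ^ 18) = false) ∧
      ((explore gs fuel st vis).map (· % 2 ^ 18)).Nodup := by
  induction fuel generalizing st vis with
  | zero => simp [explore]
  | succ fuel ih =>
    cases st with
    | nil => simp [explore]
    | cons n st =>
      simp only [explore, withNat_eq, cond_eq_ite]
      split_ifs with h
      · exact ih st vis
      · obtain ⟨h₁, h₂⟩ := ih (gs.map (act · n) ++ st) (vis ||| 1 <<< (n % 2 ^ 18))
        refine ⟨fun m hm => ?_, ?_⟩
        · rcases List.mem_cons.1 hm with rfl | hm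
          · simpa using h
          · have := h₁ m hm
            rw [Nat.testBit_or, Bool.or_eq_false_iff] at this
            exact this.1
        · rw [List.map_cons, List.nodup_cons]
          refine ⟨fun hmem => ?_, h₂⟩
          obtain ⟨m, hm, hmn⟩ := List.mem_map.1 hmem
          have := h₁ m hm
          rw [Nat.testBit_or, Bool.or_eq_false_iff, hmn, Nat.one_shiftLeft,
            Nat.testBit_two_pow_self] at this
          exact absurd this.2 (by simp)

theorem testBit_shiftLeft_add (x m s : ℕ) : (x <<< s).testBit (m + s) = x.testBit m := by
  simp [Nat.testBit_shiftLeft]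

theorem testBit_resMasks (a : ℕ → ℕ) (m n : ℕ) :
    let S := ∑ i ∈ Finset.range n, (if m.testBit i then 2 else 1) * a i
    (S % 3 = 0 → (resMasks a n).1.testBit (m % 2 ^ n)) ∧
    (S % 3 = 1 → (resMasks a n).2.1.testBit (m % 2 ^ n)) ∧
    (S % 3 = 2 → (resMasks a n).2.2.testBit (m % 2 ^ n)) := by
  induction n with
  | zero => simp [resMasks, Nat.mod_one]
  | succ n ih =>
    simp only [Finset.sum_range_succ, resMasks, withNat_eq]
    set S := ∑ i ∈ Finset.range n, (if m.testBit i then 2 else 1) * a i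
    obtain ⟨h₀, h₁, h₂⟩ := ih
    have hm : m % 2 ^ (n + 1) = m % 2 ^ n + (if m.testBit n then 2 ^ n else 0) := by
      rw [Nat.mod_pow_succ, Nat.testBit_eq_decide_div_mod_eq]
      rcases Nat.mod_two_eq_zero_or_one (m / 2 ^ n) with h | h <;> simp [h]
    rw [hm]
    have ha : a n % 3 = 0 ∨ a n % 3 = 1 ∨ a n % 3 = 2 := by omega
    cases hb : m.testBit n <;> rcases ha with ha | ha | ha <;>
      simp only [ha, Nat.testBit_or, Bool.or_eq_true, if_true, if_false, testBit_shiftLeft_add,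
        Bool.false_eq_true, Nat.add_zero] <;>
      refine ⟨fun h => ?_, fun h => ?_, fun h => ?_⟩ <;>
      first
      | exact Or.inl (h₀ (by omega))
      | exact Or.inl (h₁ (by omega))
      | exact Or.inl (h₂ (by omega))
      | exact Or.inr (h₀ (by omega))
      | exact Or.inr (h₁ (by omega))
      | exact Or.inr (h₂ (by omega))

theorem testBit_nonzeroMask {m : ℕ} (hm : m < 2 ^ 18) {k : ℕ}
    (h : (∑ i ∈ Finset.range 18, (if m.testBit i then 2 else 1) * entry i k) % 3 ≠ 0) :
    (nonzeroMask k).testBit m := by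
  obtain ⟨-, h₁, h₂⟩ := testBit_resMasks (entry · k) m 18
  rw [Nat.mod_eq_of_lt hm] at h₁ h₂
  simp only [nonzeroMask, Nat.testBit_or, Bool.or_eq_true]
  have : ∀ s : ℕ, s % 3 ≠ 0 → s % 3 = 1 ∨ s % 3 = 2 := by omega
  exact (this _ h).imp h₁ h₂

theorem testBit_candidates {m : ℕ} (K : ℕ) (h : ∀ k ≤ K, (nonzeroMask k).testBit m) :
    (candidates K).testBit m := by
  induction K with
  | zero => exact h 0 le_rfl
  | succ K ih =>
    rw [candidates, Nat.testBit_and, h (K + 1) le_rfl, ih fun k hk => h k (by omega)]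
    rfl

theorem exists_of_testBit_messageMask {m : ℕ} {l : List ℕ} (h : (messageMask l).testBit m) :
    ∃ n ∈ l, n % 2 ^ 18 = m := by
  induction l with
  | nil => simp [messageMask] at h
  | cons n l ih =>
    rw [messageMask, Nat.testBit_or, Bool.or_eq_true, Nat.one_shiftLeft,
      Nat.testBit_two_pow] at h
    rcases h with h | h
    · exact ⟨n, by simp, by simpa using h⟩
    · obtain ⟨n', hn', e⟩ := ih h
      exact ⟨n', by simp [hn'], e⟩

/-! ### The code and its words of full weight -/

/-- Numbering of `GF(17) ∪ {∞}`. -/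
def position : Option (ZMod 17) ≃ Fin 18 := (finSuccEquiv 17).symm

/-- Numbering of the coordinates. -/
def coordinate : idx ≃ Fin 36 := (Equiv.sumCongr position position).trans finSumFinEquiv

theorem coordinate_inl (a : Option (ZMod 17)) :
    (coordinate (Sum.inl a) : ℕ) = position a := rfl

/-- The word without zero coordinates whose entries equal to `2` are given by the bits of `n`. -/
def word (n : ℕ) : idx → ZMod 3 := fun j => if n.testBit (coordinate j) then 2 else 1

theorem Umat_cast (i k : Option (ZMod 17)) :
    ((Umat (ZMod 17) i k : ℤ) : ZMod 3) = entry (position i) (position k) := by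
  decide +kernel +revert

theorem mem_Lcode (v : idx → ZMod 3) :
    v ∈ Lcode (ZMod 17) ↔
      ∀ k, v (Sum.inr k) = ∑ i, v (Sum.inl i) * ((Umat (ZMod 17) i k : ℤ) : ZMod 3) := by
  constructor
  · intro hv
    induction hv using Submodule.span_induction with
    | mem x hx =>
      obtain ⟨i, rfl⟩ := hx
      intro k
      simp [genRowL]
    | zero => simp
    | add x y _ _ hx hy =>
      intro k
      simp [hx k, hy k, add_mul, Finset.sum_add_distrib]
    | smul a x _ hx =>
      intro k
      simp only [Pi.smul_apply, smul_eq_mul, hx k, Finset.mul_sum, mul_assoc]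
  · intro h
    have : v = ∑ i, v (Sum.inl i) • genRowL (ZMod 17) i := by
      funext j
      rcases j with k | k
      · simp [genRowL, Finset.sum_apply]
      · simp [genRowL, Finset.sum_apply, h k]
    rw [this]
    exact Submodule.sum_mem _ fun i _ =>
      Submodule.smul_mem _ _ (Submodule.subset_span ⟨i, rfl⟩)

theorem eq_of_inl_eq {v w : idx → ZMod 3} (hv : v ∈ Lcode (ZMod 17)) (hw : w ∈ Lcode (ZMod 17))
    (h : ∀ i, v (Sum.inl i) = w (Sum.inl i)) : v = w := by
  funext j
  rcases j with k | k
  · exact h k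
  · rw [(mem_Lcode v).1 hv, (mem_Lcode w).1 hw]
    simp only [h]

theorem word_ne_zero (n : ℕ) (j : idx) : word n j ≠ 0 := by
  unfold word
  split_ifs <;> decide

theorem word_apply_eq_iff (n m : ℕ) (j : idx) :
    word n j = word m j ↔ n.testBit (coordinate j) = m.testBit (coordinate j) := by
  unfold word
  cases n.testBit (coordinate j) <;> cases m.testBit (coordinate j) <;> decide

theorem testBit_coordinate_inl (n : ℕ) (a : Option (ZMod 17)) :
    (n % 2 ^ 18).testBit (coordinate (Sum.inl a)) = n.testBit (coordinate (Sum.inl a)) := by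
  rw [Nat.testBit_mod_two_pow, coordinate_inl]
  simp [(position a).isLt]

theorem mod_eq_of_word_eq {n m : ℕ} (h : word n = word m) : n % 2 ^ 18 = m % 2 ^ 18 := by
  apply Nat.eq_of_testBit_eq
  intro i
  rw [Nat.testBit_mod_two_pow, Nat.testBit_mod_two_pow]
  by_cases hi : i < 18
  · have := (word_apply_eq_iff n m (Sum.inl (position.symm ⟨i, hi⟩))).1 (congrFun h _)
    simpa [coordinate_inl, hi] using this
  · simp [hi]

theorem exists_word_eq {v : idx → ZMod 3} (hv : v ∈ fullWt)
    (hL : ∀ n ∈ orbitA ++ orbitB, word n ∈ Lcode (ZMod 17)) :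
    ∃ n ∈ orbitA ++ orbitB, word n = v := by
  obtain ⟨hv, hv₀⟩ := hv
  set m := Nat.ofBits fun i : Fin 18 => decide (v (Sum.inl (position.symm i)) = 2) with hmdef
  have hm : m < 2 ^ 18 := Nat.ofBits_lt_two_pow _
  have hleft : ∀ a, v (Sum.inl a) = if m.testBit (position a) then 2 else 1 := by
    intro a
    rw [hmdef, Nat.testBit_ofBits_lt _ _ (position a).isLt]
    have := hv₀ (Sum.inl a)
    simp only [Fin.eta, Equiv.symm_apply_apply, decide_eq_true_eq]
    generalize v (Sum.inl a) = x at *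
    decide +revert
  have hmask : (candidates 17).testBit m := by
    refine testBit_candidates 17 fun k hk => testBit_nonzeroMask hm fun h0 => ?_
    obtain ⟨b, hb⟩ := position.surjective ⟨k, by omega⟩
    apply hv₀ (Sum.inr b)
    rw [(mem_Lcode v).1 hv, ← Equiv.sum_comp position.symm]
    simp only [hleft, Umat_cast, Equiv.apply_symm_apply, hb]
    have := (ZMod.natCast_eq_zero_iff _ 3).2 (Nat.dvd_of_mod_eq_zero h0)
    rw [Finset.sum_range] at this
    rw [← this]
    push_cast
    exact Finset.sum_congr rfl fun i _ => by split_ifs <;> rfl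
  rw [computation.2.2.1] at hmask
  obtain ⟨n, hn, hnm⟩ := exists_of_testBit_messageMask hmask
  refine ⟨n, hn, eq_of_inl_eq (hL n hn) hv fun a => ?_⟩
  rw [hleft, word, ← testBit_coordinate_inl, hnm, coordinate_inl]

theorem hammingDist_word (n m : ℕ) : hammingDist (word n) (word m) = dist n m := by
  have hsum : dist n m = ∑ j ∈ Finset.range 36, ((n ^^^ m) >>> j) % 2 := rfl
  rw [hammingDist, Finset.card_filter, hsum, Finset.sum_range, ← Equiv.sum_comp coordinate]
  refine Finset.sum_congr rfl fun j _ => ?_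
  rw [Nat.shiftRight_eq_div_pow, ← Nat.toNat_testBit, Nat.testBit_xor]
  simp only [ne_eq, word_apply_eq_iff]
  cases n.testBit (coordinate j) <;> cases m.testBit (coordinate j) <;> rfl

/-! ### Monomial automorphisms -/

/-- The monomial matrix sending `c` to the word with `j`-th coordinate `c (σ j) * ε j`. -/
def signedPerm (σ : idx → idx) (ε : idx → ZMod 3) : Matrix idx idx (ZMod 3) :=
  fun i j => if i = σ j then ε j else 0

theorem vecMul_signedPerm (σ : idx → idx) (ε c : idx → ZMod 3) (j : idx) :
    Matrix.vecMul c (signedPerm σ ε) j = c (σ j) * ε j := by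
  simp [Matrix.vecMul, dotProduct, signedPerm]

theorem isMonomial3_iff (M : Matrix idx idx (ZMod 3)) :
    IsMonomial3 M ↔
      ∃ (σ : Equiv.Perm idx) (ε : idx → ZMod 3), (∀ j, ε j ≠ 0) ∧ M = signedPerm σ ε := by
  constructor
  · rintro ⟨hrow, hcol⟩
    choose σ hσ hσ' using hcol
    have hinj : Function.Injective σ := by
      intro j k hjk
      obtain ⟨l, -, hl⟩ := hrow (σ j)
      rw [hl j (hσ j), hl k (by simpa [hjk] using hσ k)]
    refine ⟨Equiv.ofBijective σ (Finite.injective_iff_bijective.1 hinj), fun j => M (σ j) j, hσ, ?_⟩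
    ext i j
    simp only [signedPerm, Equiv.ofBijective_apply]
    split_ifs with h
    · rw [h]
    · by_contra h0
      exact h (hσ' j i h0)
  · rintro ⟨σ, ε, hε, rfl⟩
    refine ⟨fun i => ⟨σ.symm i, ?_, fun j hj => ?_⟩, fun j => ⟨σ j, ?_, fun i hi => ?_⟩⟩
    · simp [signedPerm, hε]
    · have : i = σ j := by
        by_contra h
        simp [signedPerm, h] at hj
      simp [this]
    · simp [signedPerm, hε]
    · by_contra h
      simp [signedPerm, h] at hi

theorem vecMul_signedPerm_injective {σ : Equiv.Perm idx} {ε : idx → ZMod 3}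
    (hε : ∀ j, ε j ≠ 0) : Function.Injective fun c => Matrix.vecMul c (signedPerm σ ε) := by
  intro c d h
  funext i
  have := congrFun h (σ.symm i)
  simp only [vecMul_signedPerm, Equiv.apply_symm_apply] at this
  exact mul_right_cancel₀ (hε _) this

/-- A monomial matrix mapping the code into itself is an automorphism of the code. -/
theorem mem_monAut {σ : Equiv.Perm idx} {ε : idx → ZMod 3} (hε : ∀ j, ε j ≠ 0)
    (h : ∀ i, Matrix.vecMul (genRowL (ZMod 17) i) (signedPerm σ ε) ∈ Lcode (ZMod 17)) :
    signedPerm σ ε ∈ monAut := by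
  have hcard := Set.ncard_image_of_injective (Lcode (ZMod 17) : Set (idx → ZMod 3))
    (vecMul_signedPerm_injective (σ := σ) hε)
  have hle : Lcode (ZMod 17) ≤ (Lcode (ZMod 17)).comap (Matrix.vecMulLinear (signedPerm σ ε)) := by
    rw [Lcode, Submodule.span_le]
    rintro _ ⟨i, rfl⟩
    exact h i
  exact ⟨(isMonomial3_iff _).2 ⟨σ, ε, hε, rfl⟩,
    Set.eq_of_subset_of_ncard_le (Set.image_subset_iff.2 hle) hcard.ge (Set.toFinite _)⟩

/-- `c` is mapped to `d` by a monomial automorphism of the code. -/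
def Reach (c d : idx → ZMod 3) : Prop := ∃ M ∈ monAut, Matrix.vecMul c M = d

theorem Reach.refl (c : idx → ZMod 3) : Reach c c := by
  have h1 : (1 : Matrix idx idx (ZMod 3)) = signedPerm (1 : Equiv.Perm idx) 1 := by
    ext i j
    by_cases h : i = j <;> simp [signedPerm, Matrix.one_apply, h]
  refine ⟨1, ⟨(isMonomial3_iff _).2 ⟨1, 1, by simp, h1⟩, by simp⟩, by simp⟩

theorem Reach.trans {c d e : idx → ZMod 3} (hcd : Reach c d) (hde : Reach d e) : Reach c e := by
  obtain ⟨M, ⟨hM, hML⟩, rfl⟩ := hcd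
  obtain ⟨N, ⟨hN, hNL⟩, rfl⟩ := hde
  refine ⟨M * N, ⟨?_, ?_⟩, by rw [Matrix.vecMul_vecMul]⟩
  · obtain ⟨σ, ε, hε, rfl⟩ := (isMonomial3_iff _).1 hM
    obtain ⟨τ, δ, hδ, rfl⟩ := (isMonomial3_iff _).1 hN
    refine (isMonomial3_iff _).2 ⟨τ.trans σ, fun j => ε (τ j) * δ j,
      fun j => mul_ne_zero (hε _) (hδ _), ?_⟩
    ext i j
    simp only [Matrix.mul_apply, signedPerm, Equiv.trans_apply]
    rw [Finset.sum_eq_single (τ j)]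
    · by_cases h : i = σ (τ j) <;> simp [h]
    · simp +contextual
    · simp
  · simp only [← Matrix.vecMul_vecMul]
    rw [← Set.image_image (fun c => Matrix.vecMul c N) (fun c => Matrix.vecMul c M), hML, hNL]

theorem Reach.symm {c d : idx → ZMod 3} (hcd : Reach c d) : Reach d c := by
  obtain ⟨M, ⟨hM, hML⟩, rfl⟩ := hcd
  obtain ⟨σ, ε, hε, rfl⟩ := (isMonomial3_iff _).1 hM
  have hinv : ∀ c : idx → ZMod 3, Matrix.vecMul (Matrix.vecMul c (signedPerm σ ε))
      (signedPerm σ.symm fun j => (ε (σ.symm j))⁻¹) = c := by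
    intro c
    funext j
    simp [vecMul_signedPerm, hε]
  refine ⟨signedPerm σ.symm fun j => (ε (σ.symm j))⁻¹,
    ⟨(isMonomial3_iff _).2 ⟨σ.symm, _, fun j => inv_ne_zero (hε _), rfl⟩, ?_⟩, hinv c⟩
  conv_lhs => rw [← hML]
  rw [Set.image_image]
  simp only [hinv, Set.image_id']

theorem Reach.mem_fullWt {c d : idx → ZMod 3} (hcd : Reach c d) (hc : c ∈ fullWt) :
    d ∈ fullWt := by
  obtain ⟨M, ⟨hM, hML⟩, rfl⟩ := hcd
  obtain ⟨σ, ε, hε, rfl⟩ := (isMonomial3_iff _).1 hM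
  refine ⟨?_, fun j => ?_⟩
  · have : Matrix.vecMul c (signedPerm σ ε) ∈ (Lcode (ZMod 17) : Set (idx → ZMod 3)) :=
      hML ▸ Set.mem_image_of_mem _ hc.1
    exact this
  · rw [vecMul_signedPerm]
    exact mul_ne_zero (hc.2 _) (hε j)

/-- Some codeword of weight 36 is at Hamming distance 12 from `c`. -/
def HasNeighbor (c : idx → ZMod 3) : Prop := ∃ w ∈ fullWt, hammingDist c w = 12

theorem Reach.hasNeighbor {c d : idx → ZMod 3} (hcd : Reach c d) (hc : HasNeighbor c) :
    HasNeighbor d := by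
  obtain ⟨M, hM, rfl⟩ := hcd
  obtain ⟨w, hw, hcw⟩ := hc
  refine ⟨Matrix.vecMul w M, Reach.mem_fullWt ⟨M, hM, rfl⟩ hw, ?_⟩
  obtain ⟨σ, ε, hε, rfl⟩ := (isMonomial3_iff _).1 hM.1
  rw [← hcw, hammingDist, hammingDist, Finset.card_filter, Finset.card_filter,
    ← Equiv.sum_comp σ fun i => if c i ≠ w i then 1 else 0]
  simp [vecMul_signedPerm, hε]

/-- The source of coordinate `j` under the signed permutation encoded by `g`. -/
def source (g : List ℕ) (j : idx) : idx :=
  coordinate.symm (Fin.ofNat 36 (g.getD (coordinate j) 0 / 2))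

/-- The sign at coordinate `j` of the signed permutation encoded by `g`. -/
def sign (g : List ℕ) (j : idx) : ZMod 3 :=
  if (g.getD (coordinate j) 0).testBit 0 then 2 else 1

theorem sign_ne_zero (g : List ℕ) (j : idx) : sign g j ≠ 0 := by
  unfold sign
  split_ifs <;> decide

theorem vecMul_word {g : List ℕ} (hlen : g.length = 36) (hg : ∀ e ∈ g, e < 72) (n : ℕ) :
    Matrix.vecMul (word n) (signedPerm (source g) (sign g)) = word (act g n) := by
  funext j
  have hj : (coordinate j : ℕ) < g.length := (coordinate j).isLt.trans_eq hlen.symm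
  have he := hg _ (List.getElem_mem hj)
  have hmod : g[(coordinate j : ℕ)] / 2 % 36 = g[(coordinate j : ℕ)] / 2 :=
    Nat.mod_eq_of_lt (by omega)
  rw [vecMul_signedPerm, word, word, testBit_act g n _ hj, source, sign,
    List.getD_eq_getElem _ _ hj, Equiv.apply_symm_apply, Fin.val_ofNat, hmod]
  cases n.testBit (g[(coordinate j : ℕ)] / 2) <;> cases g[(coordinate j : ℕ)].testBit 0 <;> decide

/-- `genRowL` in terms of positions. -/
def generatorEntry (i : Option (ZMod 17)) : idx → ZMod 3
  | Sum.inl k => if i = k then 1 else 0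
  | Sum.inr k => entry (position i) (position k)

theorem genRowL_apply (i : Option (ZMod 17)) (j : idx) :
    genRowL (ZMod 17) i j = generatorEntry i j := by
  rcases j with k | k
  · rfl
  · exact Umat_cast i k

theorem generators_valid : ∀ g ∈ generators,
    g.length = 36 ∧ (∀ e ∈ g, e < 72) ∧ Function.Injective (source g) ∧
      ∀ i k, generatorEntry i (source g (Sum.inr k)) * sign g (Sum.inr k) =
        ∑ a, generatorEntry i (source g (Sum.inl a)) * sign g (Sum.inl a) *
          (entry (position a) (position k) : ZMod 3) := by
  decide +kernel

theorem reach_act {g : List ℕ} (hg : g ∈ generators) (n : ℕ) :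
    Reach (word n) (word (act g n)) := by
  obtain ⟨hlen, hlt, hinj, hcode⟩ := generators_valid g hg
  refine ⟨_, ?_, vecMul_word hlen hlt n⟩
  refine mem_monAut (σ := Equiv.ofBijective _ (Finite.injective_iff_bijective.1 hinj))
    (sign_ne_zero g) fun i => (mem_Lcode _).2 fun k => ?_
  simp only [vecMul_signedPerm, Equiv.ofBijective_apply, genRowL_apply, Umat_cast]
  exact hcode i k

theorem reach_of_mem_orbitA : ∀ n ∈ orbitA, Reach (word 0) (word n) :=
  explore_induction (R := fun n => Reach (word 0) (word n))
    (fun _ hg n hn => hn.trans (reach_act hg n)) _ _ _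
    fun n hn => by rw [List.mem_singleton.1 hn]; exact Reach.refl _

theorem reach_of_mem_orbitB : ∀ n ∈ orbitB, Reach (word 33440956) (word n) :=
  explore_induction (R := fun n => Reach (word 33440956) (word n))
    (fun _ hg n hn => hn.trans (reach_act hg n)) _ _ _
    fun n hn => by rw [List.mem_singleton.1 hn]; exact Reach.refl _

theorem word_mem_fullWt (n : ℕ) (h : ∀ k, word n (Sum.inr k) =
    ∑ i, word n (Sum.inl i) * (entry (position i) (position k) : ZMod 3)) : word n ∈ fullWt :=
  ⟨(mem_Lcode _).2 fun k => by simpa only [Umat_cast] using h k, word_ne_zero n⟩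

theorem word_seedA : word 0 ∈ fullWt := word_mem_fullWt _ (by decide +kernel)

theorem word_seedB : word 33440956 ∈ fullWt := word_mem_fullWt _ (by decide +kernel)

theorem mem_fullWt_of_mem_orbit : ∀ n ∈ orbitA ++ orbitB, word n ∈ fullWt := by
  intro n hn
  rcases List.mem_append.1 hn with hn | hn
  · exact (reach_of_mem_orbitA n hn).mem_fullWt word_seedA
  · exact (reach_of_mem_orbitB n hn).mem_fullWt word_seedB

theorem mem_fullWt_iff (v : idx → ZMod 3) :
    v ∈ fullWt ↔ ∃ n ∈ orbitA ++ orbitB, word n = v := by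
  constructor
  · exact fun hv => exists_word_eq hv fun n hn => (mem_fullWt_of_mem_orbit n hn).1
  · rintro ⟨n, hn, rfl⟩
    exact mem_fullWt_of_mem_orbit n hn

theorem not_hasNeighbor : ∀ n ∈ orbitA, ¬ HasNeighbor (word n) := by
  intro n hn h
  obtain ⟨w, hw, hdist⟩ := (reach_of_mem_orbitA n hn).symm.hasNeighbor h
  obtain ⟨m, hm, rfl⟩ := (mem_fullWt_iff w).1 hw
  rw [hammingDist_word] at hdist
  exact computation.2.2.2.1 m hm hdist

theorem hasNeighbor : ∀ n ∈ orbitB, HasNeighbor (word n) := by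
  intro n hn
  obtain ⟨m, hm, hdist⟩ := computation.2.2.2.2
  exact (reach_of_mem_orbitB n hn).hasNeighbor
    ⟨word m, mem_fullWt_of_mem_orbit m (by simp [hm]), by rw [hammingDist_word, hdist]⟩

theorem ncard_words {l : List ℕ} (hl : (l.map (· % 2 ^ 18)).Nodup) :
    Set.ncard {v | ∃ n ∈ l, word n = v} = l.length := by
  have hinj : ∀ n ∈ l, ∀ m ∈ l, word n = word m → n = m := fun n hn m hm h =>
    List.inj_on_of_nodup_map hl hn hm (mod_eq_of_word_eq h)
  have hnd : (l.map word).Nodup := (List.Nodup.of_map _ hl).map_on hinj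
  classical
  rw [show {v | ∃ n ∈ l, word n = v} = ((l.map word).toFinset : Set (idx → ZMod 3)) by
    ext v; simp, Set.ncard_coe_finset, List.toFinset_card_of_nodup hnd, List.length_map]

/-! ### The rows of the Hadamard matrix -/

/-- The rows of `H` modulo 3, as bits. -/
def hadamardRows : List ℕ :=
  [0, 12470142509, 24939760731, 49878997175, 31038779757, 62077035227, 55434855861, 42150497129,
   15581779665, 31163035043, 62325545799, 55931877005, 43144539417, 17569864241, 35139204195,
   1559193797, 3117863307, 6235202327, 524286, 12470499792, 24940737440, 49881212736,
   31042948738, 62085635332, 55451793930, 42184111126, 15648745518, 31297228892, 62594195640,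
   56468914546, 44218352358, 19717227982, 39434193820, 10148910906, 20297559668, 40594857192]

theorem Hmat_cast (i j : idx) : ((Hmat (ZMod 17) i j : ℤ) : ZMod 3) =
    word (hadamardRows.getD (coordinate i) 0) j := by
  decide +kernel +revert

theorem two_mul_word (n : ℕ) (j : idx) : 2 * word n j = word (n ^^^ (2 ^ 36 - 1)) j := by
  rw [word, word, Nat.testBit_xor, Nat.testBit_two_pow_sub_one]
  simp only [(coordinate j).isLt, decide_true]
  cases n.testBit (coordinate j) <;> decide

theorem hadamardRows_orbit :
    hadamardRows.length = 36 ∧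
    (∀ n ∈ hadamardRows, n ∈ orbitA ∧ n ^^^ (2 ^ 36 - 1) ∈ orbitA) ∧
      ∀ n ∈ orbitA, n ∈ hadamardRows ∨ n ^^^ (2 ^ 36 - 1) ∈ hadamardRows := by
  decide +kernel

theorem mem_rowsH2H_iff (v : idx → ZMod 3) : v ∈ rowsH2H ↔ ∃ n ∈ orbitA, word n = v := by
  obtain ⟨hlen, hrow, horbit⟩ := hadamardRows_orbit
  constructor
  · rintro ⟨s, i, rfl⟩
    have hi : (coordinate i : ℕ) < hadamardRows.length := (coordinate i).isLt.trans_eq hlen.symm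
    obtain ⟨h₁, h₂⟩ := hrow _ (List.getElem_mem hi)
    cases s
    · refine ⟨_, h₂, funext fun j => ?_⟩
      rw [← two_mul_word, Hmat_cast, List.getD_eq_getElem _ _ hi]
      rfl
    · refine ⟨_, h₁, funext fun j => ?_⟩
      rw [Hmat_cast, List.getD_eq_getElem _ _ hi]
      simp
  · rintro ⟨n, hn, rfl⟩
    have key : ∀ m ∈ hadamardRows, ∃ i : idx, ∀ j,
        ((Hmat (ZMod 17) i j : ℤ) : ZMod 3) = word m j := by
      intro m hm
      obtain ⟨k, hk, rfl⟩ := List.getElem_of_mem hm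
      refine ⟨coordinate.symm ⟨k, hk.trans_eq hlen⟩, fun j => ?_⟩
      rw [Hmat_cast, Equiv.apply_symm_apply, List.getD_eq_getElem _ _ hk]
    rcases horbit n hn with h | h
    · obtain ⟨i, hi⟩ := key _ h
      exact ⟨true, i, funext fun j => by simp [hi]⟩
    · obtain ⟨i, hi⟩ := key _ h
      refine ⟨false, i, funext fun j => ?_⟩
      rw [hi, ← two_mul_word, ← mul_assoc]
      exact (one_mul _).symm

theorem mem_fullWt_diff_iff (v : idx → ZMod 3) :
    v ∈ fullWt \ rowsH2H ↔ ∃ n ∈ orbitB, word n = v := by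
  rw [Set.mem_sdiff, mem_fullWt_iff, mem_rowsH2H_iff]
  constructor
  · rintro ⟨⟨n, hn, rfl⟩, h⟩
    exact ⟨n, (List.mem_append.1 hn).resolve_left fun hA => h ⟨n, hA, rfl⟩, rfl⟩
  · rintro ⟨n, hn, rfl⟩
    refine ⟨⟨n, by simp [hn], rfl⟩, ?_⟩
    rintro ⟨m, hm, h⟩
    exact not_hasNeighbor m hm (h ▸ hasNeighbor n hn)

theorem rowsH2H_subset_fullWt : rowsH2H ⊆ fullWt := by
  intro v hv
  obtain ⟨n, hn, rfl⟩ := (mem_rowsH2H_iff v).1 hv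
  exact mem_fullWt_of_mem_orbit n (by simp [hn])

theorem ncard_rowsH2H : Set.ncard rowsH2H = 72 := by
  rw [← computation.1, ← ncard_words (l := orbitA) (explore_nodup _ _ _ _).2]
  exact congrArg Set.ncard (Set.ext mem_rowsH2H_iff)

theorem ncard_fullWt_diff : Set.ncard (fullWt \ rowsH2H) = 816 := by
  rw [← computation.2.1, ← ncard_words (l := orbitB) (explore_nodup _ _ _ _).2]
  exact congrArg Set.ncard (Set.ext mem_fullWt_diff_iff)

theorem hasNeighbor_iff {v : idx → ZMod 3} (hv : v ∈ fullWt) : HasNeighbor v ↔ v ∉ rowsH2H := by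
  constructor
  · rintro h hrow
    obtain ⟨n, hn, rfl⟩ := (mem_rowsH2H_iff v).1 hrow
    exact not_hasNeighbor n hn h
  · intro h
    obtain ⟨n, hn, rfl⟩ := (mem_fullWt_diff_iff v).1 ⟨hv, h⟩
    exact hasNeighbor n hn

theorem Reach.mem_rowsH2H_iff {c d : idx → ZMod 3} (h : Reach c d) (hc : c ∈ fullWt) :
    c ∈ rowsH2H ↔ d ∈ rowsH2H := by
  rw [← not_iff_not, ← hasNeighbor_iff hc, ← hasNeighbor_iff (h.mem_fullWt hc)]
  exact ⟨h.hasNeighbor, h.symm.hasNeighbor⟩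

theorem reach_of_mem_rowsH2H {c d : idx → ZMod 3} (hc : c ∈ rowsH2H) (hd : d ∈ rowsH2H) :
    Reach c d := by
  obtain ⟨n, hn, rfl⟩ := (L17.mem_rowsH2H_iff c).1 hc
  obtain ⟨m, hm, rfl⟩ := (L17.mem_rowsH2H_iff d).1 hd
  exact (reach_of_mem_orbitA n hn).symm.trans (reach_of_mem_orbitA m hm)

theorem reach_of_mem_fullWt_diff {c d : idx → ZMod 3} (hc : c ∈ fullWt \ rowsH2H)
    (hd : d ∈ fullWt \ rowsH2H) : Reach c d := by
  obtain ⟨n, hn, rfl⟩ := (mem_fullWt_diff_iff c).1 hc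
  obtain ⟨m, hm, rfl⟩ := (mem_fullWt_diff_iff d).1 hd
  exact (reach_of_mem_orbitB n hn).symm.trans (reach_of_mem_orbitB m hm)

end L17

/-- Under the action of the full monomial automorphism group of `L(17)`, the 888
codewords of weight 36 form exactly two orbits, of lengths 72 and 816; the orbit of
length 72 consists precisely of the rows of `H` and of `2H` reduced modulo 3. -/
theorem stmt_16 :
    Set.ncard fullWt = 888 ∧
    rowsH2H ⊆ fullWt ∧
    Set.ncard rowsH2H = 72 ∧
    Set.ncard (fullWt \ rowsH2H) = 816 ∧
    -- the orbit of any row of H or 2H is exactly the set of rows of H and 2H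
    (∀ c ∈ rowsH2H, {c' | ∃ M ∈ monAut, Matrix.vecMul c M = c'} = rowsH2H) ∧
    -- the orbit of any other weight-36 codeword is the complement
    (∀ c ∈ fullWt \ rowsH2H,
      {c' | ∃ M ∈ monAut, Matrix.vecMul c M = c'} = fullWt \ rowsH2H) := by
  have hsub := L17.rowsH2H_subset_fullWt
  refine ⟨?_, hsub, L17.ncard_rowsH2H, L17.ncard_fullWt_diff, fun c hc => ?_, fun c hc => ?_⟩
  · rw [← Set.ncard_sdiff_add_ncard_of_subset hsub (Set.toFinite _), L17.ncard_fullWt_diff,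
      L17.ncard_rowsH2H]
  · ext d
    exact ⟨fun h => (L17.Reach.mem_rowsH2H_iff h (hsub hc)).1 hc,
      fun hd => L17.reach_of_mem_rowsH2H hc hd⟩
  · ext d
    exact ⟨fun h => ⟨L17.Reach.mem_fullWt h hc.1,
      fun hd => hc.2 ((L17.Reach.mem_rowsH2H_iff h hc.1).2 hd)⟩,
      fun hd => L17.reach_of_mem_fullWt_diff hc hd⟩
end
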